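/- arXiv:2108.08276 — 9 statements merged into one kernel-verified Lean document; each statement's English description precedes it below -/
import Mathlib

section
/- Every complete topologized semilattice X is weak chain•-compact, i.e., X is compact in its weak chain•-topology. -/
open Set TopologicalSpace

theorem aux_ultra {X : Type*} [SemilatticeInf X]
    [t : TopologicalSpace X]
    (hcomp : ∀ C : Set X, C.Nonempty → IsChain (· ≤ ·) C →
      ∃ a b : X, IsGLB C a ∧ IsLUB C b ∧ a ∈ closure C ∧ b ∈ closure C)
    (C : Set X) (hC : IsClosed C) (hch : IsChain (· ≤ ·) C) (F : Ultrafilter X) (hF : C ∈ F) :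
    ∃ s, ∀ U : Set X, IsOpen U → s ∈ U → U ∈ F := by
  obtain ⟨m, -, hm, -, hmC, -⟩ := hcomp C (F.nonempty_of_mem hF) hch
  rw [hC.closure_eq] at hmC
  set A : Set X := {x | x ∈ C ∧ Ici x ∈ F} with hA
  have hAC : A ⊆ C := fun x hx => hx.1
  have hmA : m ∈ A := ⟨hmC, Filter.mem_of_superset hF fun x hx => hm.1 hx⟩
  obtain ⟨-, s, -, hs, -, hsA⟩ := hcomp A ⟨m, hmA⟩ (hch.mono hAC)
  have hsC : s ∈ C := hC.closure_subset_iff.2 hAC hsA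
  refine ⟨s, fun U hU hsU => ?_⟩
  by_contra hUF
  have hUc : Uᶜ ∈ F := Ultrafilter.compl_mem_iff_notMem.2 hUF
  have key : ∀ D : Set X, D ⊆ Uᶜ → s ∉ closure D := fun D hD h =>
    (hU.isClosed_compl.closure_subset_iff.2 hD h) hsU
  by_cases h1 : Iio s ∈ F
  · have hD : C ∩ Uᶜ ∩ Iio s ∈ F := Filter.inter_mem (Filter.inter_mem hF hUc) h1
    obtain ⟨-, d, -, hd, -, hdc⟩ := hcomp _ (F.nonempty_of_mem hD)
      (hch.mono fun x hx => hx.1.1)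
    have h2 : d = s := by
      apply le_antisymm
      · exact hd.2 fun x hx => le_of_lt hx.2
      · refine hs.2 fun x hx => ?_
        obtain ⟨y, hy, hxy⟩ := F.nonempty_of_mem (Filter.inter_mem hD hx.2)
        exact le_trans hxy (hd.1 hy)
    exact key _ (fun x hx => hx.1.2) (h2 ▸ hdc)
  · have h1' : (Iio s)ᶜ ∈ F := Ultrafilter.compl_mem_iff_notMem.2 h1
    have hD : C ∩ Uᶜ ∩ (Iio s)ᶜ ∈ F := Filter.inter_mem (Filter.inter_mem hF hUc) h1'
    have hge : ∀ x ∈ C ∩ Uᶜ ∩ (Iio s)ᶜ, s ≤ x := by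
      rintro x ⟨⟨hxC, hxU⟩, hxs⟩
      rcases hch.total hsC hxC with h | h
      · exact h
      · by_contra h3
        exact hxs (lt_of_le_not_ge h h3)
    obtain ⟨d, -, hd, -, hdc, -⟩ := hcomp _ (F.nonempty_of_mem hD)
      (hch.mono fun x hx => hx.1.1)
    have hdC : d ∈ C := hC.closure_subset_iff.2 (fun x hx => hx.1.1) hdc
    have h2 : d = s := by
      apply le_antisymm
      · exact hs.1 ⟨hdC, Filter.mem_of_superset hD fun x hx => hd.1 hx⟩
      · exact hd.2 hge
    exact key _ (fun x hx => hx.1.2) (h2 ▸ hdc)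

/-- Every complete topologized semilattice is compact in its weak
chain•-topology (generated by complements of closed chains). -/
theorem complete_implies_weakChainCompact {X : Type*} [SemilatticeInf X]
    [t : TopologicalSpace X]
    (hcomp : ∀ C : Set X, C.Nonempty → IsChain (· ≤ ·) C →
      ∃ a b : X, IsGLB C a ∧ IsLUB C b ∧ a ∈ closure C ∧ b ∈ closure C) :
    @CompactSpace X (generateFrom
      {U : Set X | ∃ C : Set X, IsClosed C ∧ IsChain (· ≤ ·) C ∧ U = Cᶜ}) := by
  refine @CompactSpace.mk X (_) ?_
  refine (@isCompact_iff_ultrafilter_le_nhds X (_) _).2 fun F _ => ?_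
  have : ∃ s : X, ∀ C : Set X, IsClosed C → IsChain (· ≤ ·) C → s ∈ Cᶜ → Cᶜ ∈ F := by
    by_cases h : ∃ C : Set X, IsClosed C ∧ IsChain (· ≤ ·) C ∧ C ∈ F
    · obtain ⟨C, h1, h2, h3⟩ := h
      obtain ⟨s, hs⟩ := aux_ultra hcomp C h1 h2 F h3
      exact ⟨s, fun C hC _ h => hs _ hC.isOpen_compl h⟩
    · obtain ⟨x, -⟩ := F.nonempty_of_mem Filter.univ_mem
      exact ⟨x, fun C hC hch _ => Ultrafilter.compl_mem_iff_notMem.2 fun h' => h ⟨C, hC, hch, h'⟩⟩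
  obtain ⟨s, hs⟩ := this
  refine ⟨s, mem_univ _, ?_⟩
  rw [nhds_generateFrom]
  refine le_iInf₂ fun U hU => ?_
  obtain ⟨hsU, C, hC, hch, rfl⟩ := hU
  exact Filter.le_principal_iff.2 (hs C hC hch hsU)
end

section
/- Every weak chain•-compact topologized semilattice X is chain-compact, i.e., every closed chain in X is compact. -/
open Set TopologicalSpace

/-- Every weak chain•-compact topologized semilattice is chain-compact. -/
theorem weakChainCompact_implies_chainCompact {X : Type*} [SemilatticeInf X]
    [t : TopologicalSpace X]
    (hcpt : @CompactSpace X (generateFrom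
      {U : Set X | ∃ C : Set X, IsClosed C ∧ IsChain (· ≤ ·) C ∧ U = Cᶜ})) :
    ∀ C : Set X, IsClosed C → IsChain (· ≤ ·) C → IsCompact C := by
  intro C hC hch
  rw [isCompact_iff_ultrafilter_le_nhds]
  intro F hF
  obtain ⟨x, -, hx⟩ := (@isCompact_iff_ultrafilter_le_nhds X (generateFrom
      {U : Set X | ∃ C : Set X, IsClosed C ∧ IsChain (· ≤ ·) C ∧ U = Cᶜ}) univ).1
      hcpt.isCompact_univ F (by simp)
  have key : ∀ K : Set X, IsClosed K → IsChain (· ≤ ·) K → K ∈ F → x ∈ K := by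
    intro K hK hKc hKF
    by_contra hxK
    have h1 : Kᶜ ∈ F := hx (@IsOpen.mem_nhds X (generateFrom
      {U : Set X | ∃ C : Set X, IsClosed C ∧ IsChain (· ≤ ·) C ∧ U = Cᶜ}) x Kᶜ
      (isOpen_generateFrom_of_mem ⟨K, hK, hKc, rfl⟩) hxK)
    exact Ultrafilter.compl_mem_iff_notMem.1 h1 hKF
  have hCF : C ∈ F := by simpa using hF
  refine ⟨x, key C hC hch hCF, ?_⟩
  rw [le_nhds_iff]
  intro U hxU hU
  by_contra hUF
  have h2 : Uᶜ ∈ F := Ultrafilter.compl_mem_iff_notMem.2 hUF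
  exact (key (C ∩ Uᶜ) (hC.inter hU.isClosed_compl) (hch.mono inter_subset_left)
    (Filter.inter_mem hCF h2)).2 hxU
end

section
/- For a ↑↓-closed topologized semilattice X the following are equivalent: (1) X is complete; (2) X is weak chain•-compact; (3) X is chain-compact. -/
open Set TopologicalSpace

theorem cc_closure_chain {X : Type*} [SemilatticeInf X] [TopologicalSpace X]
    (hud : ∀ x : X, IsClosed {y : X | x ≤ y} ∧ IsClosed {y : X | y ≤ x})
    (C : Set X) (hC : IsChain (· ≤ ·) C) : IsChain (· ≤ ·) (closure C) := by
  have h1 : ∀ c ∈ C, closure C ⊆ {y | c ≤ y} ∪ {y | y ≤ c} := fun c hc =>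
    closure_minimal (fun y hy => hC.total hc hy) ((hud c).1.union (hud c).2)
  have h2 : ∀ c ∈ closure C, closure C ⊆ {y | c ≤ y} ∪ {y | y ≤ c} := fun c hc =>
    closure_minimal (fun y hy => (h1 y hy hc).symm) ((hud c).1.union (hud c).2)
  exact fun x hx y hy _ => h2 x hx hy

theorem cc_one_three {X : Type*} [SemilatticeInf X] [TopologicalSpace X]
    (h : ∀ C : Set X, C.Nonempty → IsChain (· ≤ ·) C →
        ∃ a b : X, IsGLB C a ∧ IsLUB C b ∧ a ∈ closure C ∧ b ∈ closure C)
    (C : Set X) (hc : IsClosed C) (hC : IsChain (· ≤ ·) C) : IsCompact C := by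
  rw [isCompact_iff_ultrafilter_le_nhds]
  intro f hf
  have hCf : C ∈ f := by simpa using hf
  obtain ⟨a, -, ha, -, haC, -⟩ := h C (f.nonempty_of_mem hCf) hC
  rw [hc.closure_eq] at haC
  let L : Set X := {x | x ∈ C ∧ {y | x ≤ y} ∈ f}
  have hLC : L ⊆ C := fun x hx => hx.1
  have haL : a ∈ L := ⟨haC, Filter.mem_of_superset hCf fun y hy => ha.1 hy⟩
  obtain ⟨-, s, -, hs, -, hsC⟩ := h L ⟨a, haL⟩ (hC.mono hLC)
  replace hsC : s ∈ C := closure_minimal hLC hc hsC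
  refine ⟨s, hsC, ?_⟩
  intro W hW
  obtain ⟨V, hVW, hVo, hsV⟩ := mem_nhds_iff.1 hW
  refine Filter.mem_of_superset ?_ hVW
  by_contra hV
  have hV' : Vᶜ ∈ f := Ultrafilter.compl_mem_iff_notMem.2 hV
  have hcl : IsClosed (C ∩ Vᶜ) := hc.inter hVo.isClosed_compl
  have hu : (C ∩ Vᶜ ∩ {y | y < s}) ∪ (C ∩ Vᶜ ∩ {y | s < y}) ∈ f := by
    refine Filter.mem_of_superset (Filter.inter_mem hCf hV') ?_
    rintro y ⟨hy, hyV⟩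
    have hne : y ≠ s := fun e => hyV (e ▸ hsV)
    rcases hC.total hy hsC with h' | h'
    · exact Or.inl ⟨⟨hy, hyV⟩, lt_of_le_of_ne h' hne⟩
    · exact Or.inr ⟨⟨hy, hyV⟩, lt_of_le_of_ne h' hne.symm⟩
  rcases Ultrafilter.union_mem_iff.1 hu with h1 | h1
  · obtain ⟨-, p, -, hp, -, hpc⟩ := h _ (f.nonempty_of_mem h1)
      (hC.mono fun y hy => hy.1.1)
    have hpm := closure_minimal (fun y hy => hy.1) hcl hpc
    have hps : p ≤ s := hp.2 fun y hy => le_of_lt hy.2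
    have hsp : s ≤ p := hs.2 fun x hx => by
      rcases hC.total hx.1 hpm.1 with h' | h'
      · exact h'
      · obtain ⟨y, hy, hxy⟩ := f.nonempty_of_mem (Filter.inter_mem h1 hx.2)
        exact le_trans hxy (hp.1 hy)
    exact hpm.2 (le_antisymm hsp hps ▸ hsV)
  · obtain ⟨q, -, hq, -, hqc, -⟩ := h _ (f.nonempty_of_mem h1)
      (hC.mono fun y hy => hy.1.1)
    have hqm := closure_minimal (fun y hy => hy.1) hcl hqc
    have hsq : s ≤ q := hq.2 fun y hy => le_of_lt hy.2
    have hqs : q ≤ s := hs.1 ⟨hqm.1, Filter.mem_of_superset h1 fun y hy => hq.1 hy⟩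
    exact hqm.2 (le_antisymm hsq hqs ▸ hsV)

theorem cc_three_one {X : Type*} [SemilatticeInf X] [TopologicalSpace X]
    (hud : ∀ x : X, IsClosed {y : X | x ≤ y} ∧ IsClosed {y : X | y ≤ x})
    (h : ∀ C : Set X, IsClosed C → IsChain (· ≤ ·) C → IsCompact C)
    (C : Set X) (hn : C.Nonempty) (hC : IsChain (· ≤ ·) C) :
        ∃ a b : X, IsGLB C a ∧ IsLUB C b ∧ a ∈ closure C ∧ b ∈ closure C := by
  have hK := h _ isClosed_closure (cc_closure_chain hud C hC)
  haveI : Nonempty C := hn.to_subtype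
  obtain ⟨a, ha⟩ := IsCompact.nonempty_iInter_of_directed_nonempty_isCompact_isClosed
    (fun c : C => closure C ∩ {y | y ≤ (c : X)})
    (by
      intro x y
      rcases hC.total x.2 y.2 with h' | h'
      · exact ⟨x, fun z hz => hz, fun z hz => ⟨hz.1, le_trans hz.2 h'⟩⟩
      · exact ⟨y, fun z hz => ⟨hz.1, le_trans hz.2 h'⟩, fun z hz => hz⟩)
    (fun c => ⟨c, subset_closure c.2, le_refl _⟩)
    (fun c => hK.inter_right (hud c).2) (fun c => isClosed_closure.inter (hud c).2)
  obtain ⟨b, hb⟩ := IsCompact.nonempty_iInter_of_directed_nonempty_isCompact_isClosed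
    (fun c : C => closure C ∩ {y | (c : X) ≤ y})
    (by
      intro x y
      rcases hC.total x.2 y.2 with h' | h'
      · exact ⟨y, fun z hz => ⟨hz.1, le_trans h' hz.2⟩, fun z hz => hz⟩
      · exact ⟨x, fun z hz => hz, fun z hz => ⟨hz.1, le_trans h' hz.2⟩⟩)
    (fun c => ⟨c, subset_closure c.2, le_refl _⟩)
    (fun c => hK.inter_right (hud c).1) (fun c => isClosed_closure.inter (hud c).1)
  rw [mem_iInter] at ha hb
  have hac : a ∈ closure C := (ha (Classical.arbitrary _)).1
  have hbc : b ∈ closure C := (hb (Classical.arbitrary _)).1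
  exact ⟨a, b, ⟨fun c hc => (ha ⟨c, hc⟩).2,
      fun l hl => closure_minimal (fun y hy => hl hy) (hud l).1 hac⟩,
    ⟨fun c hc => (hb ⟨c, hc⟩).2,
      fun l hl => closure_minimal (fun y hy => hl hy) (hud l).2 hbc⟩, hac, hbc⟩

theorem cc_three_two {X : Type*} [SemilatticeInf X] [t : TopologicalSpace X]
    (h : ∀ C : Set X, IsClosed C → IsChain (· ≤ ·) C → IsCompact C) :
    @CompactSpace X (generateFrom
        {U : Set X | ∃ C : Set X, IsClosed C ∧ IsChain (· ≤ ·) C ∧ U = Cᶜ}) := by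
  refine @CompactSpace.mk X (_) ?_
  rw [@isCompact_iff_ultrafilter_le_nhds X (_)]
  intro f _
  by_cases hf : ∃ C : Set X, IsClosed C ∧ IsChain (· ≤ ·) C ∧ C ∈ f
  · obtain ⟨C, hc, hC, hCf⟩ := hf
    obtain ⟨x, -, hx⟩ := isCompact_iff_ultrafilter_le_nhds.1 (h C hc hC) f (by simpa using hCf)
    refine ⟨x, mem_univ _, hx.trans ?_⟩
    apply nhds_mono
    apply le_generateFrom
    rintro U ⟨D, hD, -, rfl⟩
    exact hD.isOpen_compl
  · obtain ⟨x, -⟩ := f.nonempty_of_mem Filter.univ_mem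
    refine ⟨x, mem_univ _, ?_⟩
    rw [nhds_generateFrom]
    refine le_iInf₂ ?_
    rintro U ⟨-, D, hD, hD', rfl⟩
    rw [Filter.le_principal_iff]
    exact Ultrafilter.compl_mem_iff_notMem.2 fun hm => hf ⟨D, hD, hD', hm⟩

theorem cc_two_three {X : Type*} [SemilatticeInf X] [t : TopologicalSpace X]
    (h : @CompactSpace X (generateFrom
        {U : Set X | ∃ C : Set X, IsClosed C ∧ IsChain (· ≤ ·) C ∧ U = Cᶜ}))
    (C : Set X) (hc : IsClosed C) (hC : IsChain (· ≤ ·) C) : IsCompact C := by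
  rw [isCompact_iff_ultrafilter_le_nhds]
  intro f hf
  have hCf : C ∈ f := by simpa using hf
  obtain ⟨x, -, hx⟩ := (@isCompact_iff_ultrafilter_le_nhds X (_) _).1
    (@CompactSpace.isCompact_univ X (_) h) f (by simp)
  rw [nhds_generateFrom] at hx
  have key : ∀ D : Set X, IsClosed D → IsChain (· ≤ ·) D → x ∉ D → Dᶜ ∈ f := by
    intro D hD hD' hxD
    have := hx.trans (iInf₂_le Dᶜ ⟨hxD, D, hD, hD', rfl⟩)
    rwa [Filter.le_principal_iff] at this
  have hxC : x ∈ C := by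
    by_contra hxC
    exact Ultrafilter.compl_mem_iff_notMem.1 (key C hc hC hxC) hCf
  refine ⟨x, hxC, ?_⟩
  intro W hW
  obtain ⟨V, hVW, hVo, hsV⟩ := mem_nhds_iff.1 hW
  refine Filter.mem_of_superset (Filter.inter_mem hCf (key (C ∩ Vᶜ)
    (hc.inter hVo.isClosed_compl) (hC.mono inter_subset_left) fun hh => hh.2 hsV)) ?_
  rintro y ⟨hy, hy'⟩
  by_contra hyW
  exact hy' ⟨hy, fun hyV => hyW (hVW hyV)⟩

/-- For a ↑↓-closed topologized semilattice the following are equivalent: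
completeness, weak chain•-compactness, chain-compactness. -/
theorem complete_tfae {X : Type*} [SemilatticeInf X] [t : TopologicalSpace X]
    (hud : ∀ x : X, IsClosed {y : X | x ≤ y} ∧ IsClosed {y : X | y ≤ x}) :
    List.TFAE
      [∀ C : Set X, C.Nonempty → IsChain (· ≤ ·) C →
        ∃ a b : X, IsGLB C a ∧ IsLUB C b ∧ a ∈ closure C ∧ b ∈ closure C,
      @CompactSpace X (generateFrom
        {U : Set X | ∃ C : Set X, IsClosed C ∧ IsChain (· ≤ ·) C ∧ U = Cᶜ}),
      ∀ C : Set X, IsClosed C → IsChain (· ≤ ·) C → IsCompact C] := by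
  tfae_have 1 → 3 := cc_one_three
  tfae_have 3 → 1 := cc_three_one hud
  tfae_have 3 → 2 := cc_three_two
  tfae_have 2 → 3 := cc_two_three
  tfae_finish
end

section
/- A ↑↓-closed topologized semilattice X is complete if and only if every non-empty closed chain C ⊆ X contains a greatest lower bound of C and a least upper bound of C (i.e., C has a smallest and a largest element which are inf C and sup C in X). -/
open Set

/-- A ↑↓-closed topologized semilattice is complete iff every non-empty
closed chain contains its greatest lower bound and least upper bound. -/
theorem complete_iff_closed_chains_have_inf_sup {X : Type*} [SemilatticeInf X]
    [TopologicalSpace X]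
    (hud : ∀ x : X, IsClosed {y : X | x ≤ y} ∧ IsClosed {y : X | y ≤ x}) :
    (∀ C : Set X, C.Nonempty → IsChain (· ≤ ·) C →
      ∃ a b : X, IsGLB C a ∧ IsLUB C b ∧ a ∈ closure C ∧ b ∈ closure C) ↔
    (∀ C : Set X, C.Nonempty → IsClosed C → IsChain (· ≤ ·) C →
      ∃ a b : X, a ∈ C ∧ b ∈ C ∧ IsGLB C a ∧ IsLUB C b) := by
  constructor
  · intro h C hne hcl hch
    obtain ⟨a, b, ha, hb, hac, hbc⟩ := h C hne hch
    rw [hcl.closure_eq] at hac hbc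
    exact ⟨a, b, hac, hbc, ha, hb⟩
  · intro h C hne hch
    have hcl : ∀ x : X, IsClosed ({y : X | x ≤ y} ∪ {y : X | y ≤ x}) :=
      fun x => (hud x).1.union (hud x).2
    have h1 : ∀ c ∈ C, ∀ y ∈ closure C, c ≤ y ∨ y ≤ c := fun c hc y hy =>
      closure_minimal (fun d hd => hch.total hc hd) (hcl c) hy
    have h2 : ∀ x ∈ closure C, ∀ y ∈ closure C, x ≤ y ∨ y ≤ x := fun x hx y hy =>
      closure_minimal (fun d hd => (h1 d hd x hx).symm) (hcl x) hy
    obtain ⟨a, b, ha, hb, hga, hlb⟩ := h (closure C) hne.closure isClosed_closure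
      (fun x hx y hy _ => h2 x hx y hy)
    refine ⟨a, b, ⟨fun c hc => hga.1 (subset_closure hc), fun z hz => ?_⟩,
      ⟨fun c hc => hlb.1 (subset_closure hc), fun z hz => ?_⟩, ha, hb⟩
    · exact closure_minimal (fun d hd => hz hd) (hud z).1 ha
    · exact closure_minimal (fun d hd => hz hd) (hud z).2 hb
end

section
/- Let X be a complete topologized semilattice, Y a ↑↓-closed topologized semilattice, and Φ : X → (subsets of Y) an upper semicontinuous T1 multimorphism such that for any x, y ∈ X the inequality x ≤ y implies Φ(x) ∩ ↑Φ(y) ⊆ Φ(y), where ↑B = {z ∈ Y : ∃ b ∈ B, b ≤ z}. Then the subsemilattice Φ(X) = ⋃_{x ∈ X} Φ(x) is complete if and only if the subsemilattice Φ(x) is complete for every x ∈ X. -/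
open Set

/-- A subset `S` of a topologized semilattice `Y` is complete as a topologized
subsemilattice: every non-empty chain `C ⊆ S` has a greatest lower bound and a least
upper bound among the elements of `S`, both belonging to the closure of `C` in `Y`. -/
def SubComplete {Y : Type*} [SemilatticeInf Y] [TopologicalSpace Y] (S : Set Y) : Prop :=
  ∀ C : Set Y, C ⊆ S → C.Nonempty → IsChain (· ≤ ·) C →
    ∃ a b : Y, a ∈ S ∧ b ∈ S ∧
      a ∈ lowerBounds C ∧ (∀ c ∈ S, c ∈ lowerBounds C → c ≤ a) ∧
      b ∈ upperBounds C ∧ (∀ c ∈ S, c ∈ upperBounds C → b ≤ c) ∧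
      a ∈ closure C ∧ b ∈ closure C

/-- For an upper semicontinuous `T1` multimorphism `Φ` from a complete
topologized semilattice to a ↑↓-closed topologized semilattice such that `x ≤ y` implies
`Φ(x) ∩ ↑Φ(y) ⊆ Φ(y)`, the semilattice `Φ(X)` is complete iff each `Φ(x)` is complete. -/
theorem multimorphism_image_complete_iff {X Y : Type*}
    [SemilatticeInf X] [TopologicalSpace X] [SemilatticeInf Y] [TopologicalSpace Y]
    (hX : ∀ C : Set X, C.Nonempty → IsChain (· ≤ ·) C →
      ∃ a b : X, IsGLB C a ∧ IsLUB C b ∧ a ∈ closure C ∧ b ∈ closure C)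
    (hY : ∀ y : Y, IsClosed {z : Y | y ≤ z} ∧ IsClosed {z : Y | z ≤ y})
    (Φ : X → Set Y)
    (husc : ∀ F : Set Y, IsClosed F → IsClosed {x : X | (Φ x ∩ F).Nonempty})
    (hT1 : ∀ x : X, ∀ z ∉ Φ x, ∃ U : Set Y, IsOpen U ∧ z ∈ U ∧ U ∩ Φ x = ∅)
    (hmul : ∀ x y : X, ∀ a ∈ Φ x, ∀ b ∈ Φ y, a ⊓ b ∈ Φ (x ⊓ y))
    (hmono : ∀ x y : X, x ≤ y → Φ x ∩ {z : Y | ∃ b ∈ Φ y, b ≤ z} ⊆ Φ y) :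
    SubComplete (⋃ x : X, Φ x) ↔ ∀ x : X, SubComplete (Φ x) := by
  classical
  have hcl : ∀ x, IsClosed (Φ x) := by
    intro x
    rw [← isOpen_compl_iff, isOpen_iff_forall_mem_open]
    intro z hz
    obtain ⟨U, hU, hzU, hd⟩ := hT1 x z hz
    refine ⟨U, ?_, hU, hzU⟩
    intro w hw hw2
    have : w ∈ U ∩ Φ x := ⟨hw, hw2⟩
    rw [hd] at this
    exact this
  constructor
  · intro h x C hC hne hch
    obtain ⟨a, b, -, -, h1, h2, h3, h4, h5, h6⟩ :=
      h C (hC.trans (subset_iUnion Φ x)) hne hch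
    exact ⟨a, b, closure_minimal hC (hcl x) h5, closure_minimal hC (hcl x) h6, h1,
      fun c hc => h2 c (mem_iUnion.2 ⟨x, hc⟩), h3,
      fun c hc => h4 c (mem_iUnion.2 ⟨x, hc⟩), h5, h6⟩
  intro h C hC hne hch
  -- least preimages
  have hmin : ∀ c ∈ C, ∃ m : X, c ∈ Φ m ∧ ∀ x, c ∈ Φ x → m ≤ x := by
    intro c hc
    obtain ⟨x₀, hx₀⟩ := mem_iUnion.1 (hC hc)
    have hclosed : IsClosed {x : X | c ∈ Φ x} := by
      have := husc ({z | c ≤ z} ∩ {z | z ≤ c}) ((hY c).1.inter (hY c).2)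
      convert this using 1
      ext x
      constructor
      · intro hx
        exact ⟨c, hx, le_refl c, le_refl c⟩
      · rintro ⟨z, hz, h1, h2⟩
        have : z = c := le_antisymm h2 h1
        exact this ▸ hz
    have : Nonempty {x : X // c ∈ Φ x} := ⟨⟨x₀, hx₀⟩⟩
    obtain ⟨m, hm⟩ := exists_maximal_of_nonempty_chains_bounded
      (α := {x : X // c ∈ Φ x}) (r := fun a b => b.1 ≤ a.1) (by
        intro D hD hDne
        obtain ⟨a, _, ha, -, hacl, -⟩ := hX (Subtype.val '' D) (hDne.image _) (by
          rintro _ ⟨p, hp, rfl⟩ _ ⟨q, hq, rfl⟩ hpq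
          exact (hD hp hq (fun e => hpq (by rw [e]))).symm)
        have hac : c ∈ Φ a := by
          refine closure_minimal (t := {x : X | c ∈ Φ x}) ?_ hclosed hacl
          rintro _ ⟨p, hp, rfl⟩
          exact p.2
        exact ⟨⟨a, hac⟩, fun p hp => ha.1 ⟨p, hp, rfl⟩⟩)
      (fun h1 h2 => le_trans h2 h1)
    refine ⟨m.1, m.2, fun x hx => ?_⟩
    have hmx : c ∈ Φ (m.1 ⊓ x) := by
      have := hmul m.1 x c m.2 c hx
      rwa [inf_idem] at this
    exact (hm ⟨m.1 ⊓ x, hmx⟩ inf_le_left).trans inf_le_right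
  have hXne : Nonempty X := by
    obtain ⟨c, hc⟩ := hne
    obtain ⟨x, -⟩ := mem_iUnion.1 (hC hc)
    exact ⟨x⟩
  choose! f hf hfmin using hmin
  have hfmono : ∀ c ∈ C, ∀ d ∈ C, c ≤ d → f c ≤ f d := by
    intro c hc d hd hcd
    have := hmul _ _ c (hf c hc) d (hf d hd)
    rw [inf_eq_left.2 hcd] at this
    exact (hfmin c hc _ this).trans inf_le_right
  have himch : ∀ E ⊆ C, IsChain (· ≤ ·) (f '' E) := by
    rintro E hE _ ⟨p, hp, rfl⟩ _ ⟨q, hq, rfl⟩ -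
    rcases hch.total (hE hp) (hE hq) with hpq | hpq
    · exact Or.inl (hfmono _ (hE hp) _ (hE hq) hpq)
    · exact Or.inr (hfmono _ (hE hq) _ (hE hp) hpq)
  have hcmp : ∀ c ∈ C, ∀ z ∈ closure C, c ≤ z ∨ z ≤ c := by
    intro c hc z hz
    exact closure_minimal (t := {z | c ≤ z} ∪ {z | z ≤ c})
      (fun w hw => hch.total hc hw) ((hY c).1.union (hY c).2) hz
  have hcmp2 : ∀ y ∈ closure C, ∀ z ∈ closure C, y ≤ z ∨ z ≤ y := by
    intro y hy z hz
    exact closure_minimal (t := {z | y ≤ z} ∪ {z | z ≤ y})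
      (fun w hw => (hcmp w hw y hy).symm) ((hY y).1.union (hY y).2) hz
  have hK : ∀ x, IsChain (· ≤ ·) (Φ x ∩ closure C) :=
    fun x y hy z hz _ => hcmp2 y hy.2 z hz.2
  have hKcl : ∀ x, closure (Φ x ∩ closure C) ⊆ closure C :=
    fun x => closure_minimal inter_subset_right isClosed_closure
  obtain ⟨c₀, hc₀⟩ := hne
  obtain ⟨p, q, hp, hq, -, -⟩ := hX (f '' C) ⟨_, c₀, hc₀, rfl⟩ (himch C Subset.rfl)
  have hlow : ∀ c ∈ C, ∃ z ∈ Φ p ∩ closure C, z ≤ c := by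
    intro c hc
    obtain ⟨p', _, hp', -, hcl', -⟩ := hX (f '' {d ∈ C | d ≤ c}) ⟨_, c, ⟨hc, le_refl c⟩, rfl⟩
      (himch _ (sep_subset _ _))
    have hpp : p' = p := by
      refine le_antisymm (hp.2 ?_) (hp'.2 ?_)
      · rintro _ ⟨d, hd, rfl⟩
        rcases hch.total hd hc with hdc | hdc
        · exact hp'.1 ⟨d, ⟨hd, hdc⟩, rfl⟩
        · exact (hp'.1 ⟨c, ⟨hc, le_refl c⟩, rfl⟩).trans (hfmono _ hc _ hd hdc)
      · rintro _ ⟨d, hd, rfl⟩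
        exact hp.1 ⟨d, hd.1, rfl⟩
    subst hpp
    obtain ⟨z, hz, hz1, hz2⟩ := closure_minimal
      (t := {x : X | (Φ x ∩ (closure C ∩ {z | z ≤ c})).Nonempty}) (by
        rintro _ ⟨d, hd, rfl⟩
        exact ⟨d, hf d hd.1, subset_closure hd.1, hd.2⟩)
      (husc _ (isClosed_closure.inter (hY c).2)) hcl'
    exact ⟨z, ⟨hz, hz1⟩, hz2⟩
  have hupp : ∀ c ∈ C, ∃ z ∈ Φ q ∩ closure C, c ≤ z := by
    intro c hc
    obtain ⟨_, q', -, hq', -, hcl'⟩ := hX (f '' {d ∈ C | c ≤ d}) ⟨_, c, ⟨hc, le_refl c⟩, rfl⟩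
      (himch _ (sep_subset _ _))
    have hqq : q' = q := by
      refine le_antisymm (hq'.2 ?_) (hq.2 ?_)
      · rintro _ ⟨d, hd, rfl⟩
        exact hq.1 ⟨d, hd.1, rfl⟩
      · rintro _ ⟨d, hd, rfl⟩
        rcases hch.total hc hd with hdc | hdc
        · exact hq'.1 ⟨d, ⟨hd, hdc⟩, rfl⟩
        · exact (hfmono _ hd _ hc hdc).trans (hq'.1 ⟨c, ⟨hc, le_refl c⟩, rfl⟩)
    subst hqq
    obtain ⟨z, hz, hz1, hz2⟩ := closure_minimal
      (t := {x : X | (Φ x ∩ (closure C ∩ {z | c ≤ z})).Nonempty}) (by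
        rintro _ ⟨d, hd, rfl⟩
        exact ⟨d, hf d hd.1, subset_closure hd.1, hd.2⟩)
      (husc _ (isClosed_closure.inter (hY c).1)) hcl'
    exact ⟨z, ⟨hz, hz1⟩, hz2⟩
  obtain ⟨a, _, ha, -, ha1, -, -, -, ha2, -⟩ := h p (Φ p ∩ closure C) inter_subset_left
    (let ⟨z, hz, _⟩ := hlow c₀ hc₀; ⟨z, hz⟩) (hK p)
  obtain ⟨_, b, -, hb, -, -, hb1, -, -, hb2⟩ := h q (Φ q ∩ closure C) inter_subset_left
    (let ⟨z, hz, _⟩ := hupp c₀ hc₀; ⟨z, hz⟩) (hK q)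
  refine ⟨a, b, mem_iUnion.2 ⟨p, ha⟩, mem_iUnion.2 ⟨q, hb⟩, ?_, ?_, ?_, ?_,
    hKcl p ha2, hKcl q hb2⟩
  · intro c hc
    obtain ⟨z, hz, hzc⟩ := hlow c hc
    exact (ha1 hz).trans hzc
  · intro l _ hl
    exact closure_minimal (t := {z | l ≤ z}) (fun c hc => hl hc) (hY l).1 (hKcl p ha2)
  · intro c hc
    obtain ⟨z, hz, hzc⟩ := hupp c hc
    exact hzc.trans (hb1 hz)
  · intro u _ hu
    exact closure_minimal (t := {z | z ≤ u}) (fun c hc => hu hc) (hY u).2 (hKcl q hb2)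
end

section
/- Let X be a complete topologized semilattice, Y a ↑↓-closed topologized semilattice, and Φ : X → (subsets of Y) an upper semicontinuous T1 multimorphism such that Φ(x) ∩ Φ(y) = ∅ whenever x ≠ y. Then the subsemilattice Φ(X) = ⋃_{x ∈ X} Φ(x) is complete if and only if the subsemilattice Φ(x) is complete for every x ∈ X. -/
open Set

/-- For an upper semicontinuous `T1` multimorphism `Φ` with pairwise
disjoint values, from a complete topologized semilattice to a ↑↓-closed topologized
semilattice, the semilattice `Φ(X)` is complete iff each `Φ(x)` is complete. -/
theorem disjoint_multimorphism_image_complete_iff {X Y : Type*}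
    [SemilatticeInf X] [TopologicalSpace X] [SemilatticeInf Y] [TopologicalSpace Y]
    (hX : ∀ C : Set X, C.Nonempty → IsChain (· ≤ ·) C →
      ∃ a b : X, IsGLB C a ∧ IsLUB C b ∧ a ∈ closure C ∧ b ∈ closure C)
    (hY : ∀ y : Y, IsClosed {z : Y | y ≤ z} ∧ IsClosed {z : Y | z ≤ y})
    (Φ : X → Set Y)
    (husc : ∀ F : Set Y, IsClosed F → IsClosed {x : X | (Φ x ∩ F).Nonempty})
    (hT1 : ∀ x : X, ∀ z ∉ Φ x, ∃ U : Set Y, IsOpen U ∧ z ∈ U ∧ U ∩ Φ x = ∅)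
    (hmul : ∀ x y : X, ∀ a ∈ Φ x, ∀ b ∈ Φ y, a ⊓ b ∈ Φ (x ⊓ y))
    (hdisj : ∀ x y : X, x ≠ y → Φ x ∩ Φ y = ∅) :
    SubComplete (⋃ x : X, Φ x) ↔ ∀ x : X, SubComplete (Φ x) := by
  have huniq : ∀ x y a, a ∈ Φ x → a ∈ Φ y → x = y := by
    intro x y a hx hy
    by_contra h
    have : a ∈ Φ x ∩ Φ y := ⟨hx, hy⟩
    rw [hdisj x y h] at this
    exact this
  have hmono : ∀ x y a b, a ∈ Φ x → b ∈ Φ y → a ≤ b → x ≤ y := by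
    intro x y a b ha hb hab
    have h := hmul x y a ha b hb
    rw [inf_eq_left.mpr hab] at h
    exact inf_eq_left.mp (huniq _ _ _ h ha)
  have hcl : ∀ x, IsClosed (Φ x) := by
    intro x
    rw [← isOpen_compl_iff, isOpen_iff_forall_mem_open]
    intro z hz
    obtain ⟨U, hU, hzU, hd⟩ := hT1 x z hz
    refine ⟨U, fun u hu hux => ?_, hU, hzU⟩
    have : u ∈ U ∩ Φ x := ⟨hu, hux⟩
    rw [hd] at this
    exact this
  constructor
  · intro H x C hC hne hch
    obtain ⟨a, b, -, -, h1, h2, h3, h4, h5, h6⟩ :=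
      H C (hC.trans (subset_iUnion Φ x)) hne hch
    exact ⟨a, b, (hcl x).closure_subset_iff.mpr hC h5, (hcl x).closure_subset_iff.mpr hC h6, h1,
      fun c hc => h2 c (mem_iUnion.mpr ⟨x, hc⟩), h3,
      fun c hc => h4 c (mem_iUnion.mpr ⟨x, hc⟩), h5, h6⟩
  · intro H C hC hne hch
    have hC' : ∀ c ∈ C, ∃ x, c ∈ Φ x := fun c hc => mem_iUnion.mp (hC hc)
    have htot : ∀ c ∈ C, ∀ d ∈ C, c ≤ d ∨ d ≤ c := fun c hc d hd => hch.total hc hd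
    have hcomp : ∀ y ∈ closure C, ∀ c ∈ C, y ≤ c ∨ c ≤ y := by
      intro y hy c hc
      have hcl2 : IsClosed ({z : Y | z ≤ c} ∪ {z : Y | c ≤ z}) := (hY c).2.union (hY c).1
      exact hcl2.closure_subset_iff.mpr (fun d hd => htot d hd c hc) hy
    set P : Set X := {x | (Φ x ∩ C).Nonempty} with hP
    have hPne : P.Nonempty := by
      obtain ⟨c, hc⟩ := hne
      obtain ⟨x, hx⟩ := hC' c hc
      exact ⟨x, c, hx, hc⟩
    have hPch : IsChain (· ≤ ·) P := by
      rintro x ⟨c, hcx, hc⟩ y ⟨d, hdy, hd⟩ -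
      rcases htot c hc d hd with h | h
      · exact Or.inl (hmono _ _ _ _ hcx hdy h)
      · exact Or.inr (hmono _ _ _ _ hdy hcx h)
    obtain ⟨p, q, hp, hq, hpc, hqc⟩ := hX P hPne hPch
    have hmeet : ∀ x ∈ closure P, (Φ x ∩ closure C).Nonempty := by
      intro x hx
      refine (husc _ isClosed_closure).closure_subset_iff.mpr ?_ hx
      rintro y ⟨c, hcy, hc⟩
      exact ⟨c, hcy, subset_closure hc⟩
    have hlow : ∃ a ∈ Φ p, a ∈ lowerBounds C ∧ a ∈ closure C := by
      by_cases hpP : p ∈ P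
      · obtain ⟨a, -, ha, -, h1, -, -, -, h5, -⟩ := H p (Φ p ∩ C) inter_subset_left hpP
          (hch.mono inter_subset_right)
        refine ⟨a, ha, fun c hc => ?_, closure_mono inter_subset_right h5⟩
        obtain ⟨d, hdp, hd⟩ := hpP
        rcases htot c hc d hd with h | h
        · obtain ⟨x, hx⟩ := hC' c hc
          have hxp : x = p := le_antisymm (hmono _ _ _ _ hx hdp h) (hp.1 ⟨c, hx, hc⟩)
          exact h1 ⟨hxp ▸ hx, hc⟩
        · exact (h1 ⟨hdp, hd⟩).trans h
      · obtain ⟨y, hyp, hy⟩ := hmeet p hpc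
        refine ⟨y, hyp, fun c hc => (hcomp y hy c hc).resolve_right fun h => hpP ?_, hy⟩
        obtain ⟨x, hx⟩ := hC' c hc
        have hxp : x = p := le_antisymm (hmono _ _ _ _ hx hyp h) (hp.1 ⟨c, hx, hc⟩)
        exact ⟨c, hxp ▸ hx, hc⟩
    have hup : ∃ b ∈ Φ q, b ∈ upperBounds C ∧ b ∈ closure C := by
      by_cases hqP : q ∈ P
      · obtain ⟨-, b, -, hb, -, -, h1, -, -, h5⟩ := H q (Φ q ∩ C) inter_subset_left hqP
          (hch.mono inter_subset_right)
        refine ⟨b, hb, fun c hc => ?_, closure_mono inter_subset_right h5⟩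
        obtain ⟨d, hdq, hd⟩ := hqP
        rcases htot d hd c hc with h | h
        · obtain ⟨x, hx⟩ := hC' c hc
          have hxq : x = q := le_antisymm (hq.1 ⟨c, hx, hc⟩) (hmono _ _ _ _ hdq hx h)
          exact h1 ⟨hxq ▸ hx, hc⟩
        · exact h.trans (h1 ⟨hdq, hd⟩)
      · obtain ⟨y, hyq, hy⟩ := hmeet q hqc
        refine ⟨y, hyq, fun c hc => (hcomp y hy c hc).resolve_left fun h => hqP ?_, hy⟩
        obtain ⟨x, hx⟩ := hC' c hc
        have hxq : x = q := le_antisymm (hq.1 ⟨c, hx, hc⟩) (hmono _ _ _ _ hyq hx h)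
        exact ⟨c, hxq ▸ hx, hc⟩
    obtain ⟨a, hap, hal, hac⟩ := hlow
    obtain ⟨b, hbq, hbu, hbc⟩ := hup
    refine ⟨a, b, mem_iUnion.mpr ⟨p, hap⟩, mem_iUnion.mpr ⟨q, hbq⟩, hal, ?_, hbu, ?_, hac, hbc⟩
    · intro c _ hc
      exact (hY c).1.closure_subset_iff.mpr (fun d hd => hc hd) hac
    · intro c _ hc
      exact (hY c).2.closure_subset_iff.mpr (fun d hd => hc hd) hbc
end

section
/- Let Y be a Hausdorff topological semilattice (the meet operation is jointly continuous) and X ⊆ Y a subsemilattice with the subspace topology. If there exists a semilattice homomorphism h : X → E into a complete topologized semilattice E which is a closed map (the image under h of every set closed in X is closed in E) and such that for each e ∈ E the fiber h⁻¹(e) is θ-closed in Y, then X is closed in Y. -/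
open Set

/-- The θ-closure of a set in a topological space. -/
def thetaCl {Y : Type*} [TopologicalSpace Y] (A : Set Y) : Set Y :=
  {x | ∀ U : Set Y, IsOpen U → x ∈ U → (closure U ∩ A).Nonempty}


structure GoodSet {E : Type*} [SemilatticeInf E] (K : Set E) : Prop where
  inf : ∀ a ∈ K, ∀ b ∈ K, a ⊓ b ∈ K
  glb : ∀ C ⊆ K, C.Nonempty → IsChain (· ≤ ·) C → ∀ a, IsGLB C a → a ∈ K
  lub : ∀ C ⊆ K, C.Nonempty → IsChain (· ≤ ·) C → ∀ a, IsLUB C a → a ∈ K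

theorem GoodSet.inter {E : Type*} [SemilatticeInf E] {K L : Set E} (hK : GoodSet K)
    (hL : GoodSet L) : GoodSet (K ∩ L) :=
  ⟨fun a ha b hb => ⟨hK.inf a ha.1 b hb.1, hL.inf a ha.2 b hb.2⟩,
   fun C hC hn hc a ha => ⟨hK.glb C (fun x hx => (hC hx).1) hn hc a ha,
     hL.glb C (fun x hx => (hC hx).2) hn hc a ha⟩,
   fun C hC hn hc a ha => ⟨hK.lub C (fun x hx => (hC hx).1) hn hc a ha,
     hL.lub C (fun x hx => (hC hx).2) hn hc a ha⟩⟩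

theorem GoodSet.sInter {E : Type*} [SemilatticeInf E] {c : Set (Set E)}
    (hc : ∀ K ∈ c, GoodSet K) : GoodSet (⋂₀ c) :=
  ⟨fun a ha b hb K hK => (hc K hK).inf a (ha K hK) b (hb K hK),
   fun C hC hn hch a ha K hK => (hc K hK).glb C (fun x hx => hC hx K hK) hn hch a ha,
   fun C hC hn hch a ha K hK => (hc K hK).lub C (fun x hx => hC hx K hK) hn hch a ha⟩

theorem GoodSet.exists_min {E : Type*} [SemilatticeInf E]
    (hE : ∀ C : Set E, C.Nonempty → IsChain (· ≤ ·) C →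
      (∃ a, IsGLB C a) ∧ (∃ b, IsLUB C b)) {K : Set E} (hK : GoodSet K) (hne : K.Nonempty) :
    ∃ m, IsLeast K m := by
  obtain ⟨x0, hx0⟩ := hne
  obtain ⟨m, hm⟩ := zorn_le₀ (α := Eᵒᵈ) (OrderDual.ofDual ⁻¹' K) (by
    intro c hcK hc
    by_cases hcn : c.Nonempty
    · have hc' : IsChain (· ≤ ·) (OrderDual.toDual ⁻¹' c : Set E) := by
        intro a ha b hb hab
        exact (hc ha hb hab).symm
      obtain ⟨⟨a, ha⟩, -⟩ := hE (OrderDual.toDual ⁻¹' c) hcn hc'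
      exact ⟨OrderDual.toDual a, hK.glb _ (fun x hx => hcK hx) hcn hc' a ha,
        fun z hz => ha.1 hz⟩
    · exact ⟨OrderDual.toDual x0, hx0, fun z hz => (hcn ⟨z, hz⟩).elim⟩)
  refine ⟨OrderDual.ofDual m, hm.1, fun z hz => ?_⟩
  have h1 := hm.2 (y := OrderDual.toDual (OrderDual.ofDual m ⊓ z)) (hK.inf _ hm.1 _ hz)
    (inf_le_left : OrderDual.ofDual m ⊓ z ≤ OrderDual.ofDual m)
  have h2 : OrderDual.ofDual m ≤ OrderDual.ofDual m ⊓ z := h1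
  exact h2.trans inf_le_right

theorem GoodSet.chain_nonempty {E : Type*} [SemilatticeInf E]
    (hE : ∀ C : Set E, C.Nonempty → IsChain (· ≤ ·) C →
      (∃ a, IsGLB C a) ∧ (∃ b, IsLUB C b)) {c : Set (Set E)}
    (hc : ∀ K ∈ c, GoodSet K ∧ K.Nonempty) (hch : IsChain (· ⊆ ·) c) (hcn : c.Nonempty) :
    (⋂₀ c).Nonempty := by
  have hmin : ∀ K : c, ∃ m, IsLeast (K : Set E) m := fun K =>
    (hc K K.2).1.exists_min hE (hc K K.2).2
  choose m hm using hmin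
  have hmono : ∀ K L : c, (K : Set E) ⊆ L → m L ≤ m K := fun K L hKL =>
    (hm L).2 (hKL (hm K).1)
  have htot : ∀ K L : c, (K : Set E) ⊆ L ∨ (L : Set E) ⊆ K := fun K L => hch.total K.2 L.2
  have hchain : IsChain (· ≤ ·) (range m) := by
    rintro _ ⟨K, rfl⟩ _ ⟨L, rfl⟩ -
    exact (htot K L).symm.imp (hmono L K) (hmono K L)
  obtain ⟨K0, hK0⟩ := hcn
  obtain ⟨-, b, hb⟩ := hE (range m) ⟨_, ⟨K0, hK0⟩, rfl⟩ hchain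
  refine ⟨b, fun K hK => ?_⟩
  refine (hc K hK).1.lub (m '' {L | (L : Set E) ⊆ K}) ?_ ⟨_, ⟨K, hK⟩, Subset.rfl, rfl⟩
    (hchain.mono (image_subset_range _ _)) b ⟨?_, ?_⟩
  · rintro _ ⟨L, hL, rfl⟩
    exact hL (hm L).1
  · rintro _ ⟨L, hL, rfl⟩
    exact hb.1 ⟨L, rfl⟩
  · intro z hz
    apply hb.2
    rintro _ ⟨L, rfl⟩
    rcases htot L ⟨K, hK⟩ with h1 | h1
    · exact hz ⟨L, h1, rfl⟩
    · exact (hmono _ _ h1).trans (hz ⟨⟨K, hK⟩, Subset.rfl, rfl⟩)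

theorem GoodSet.directed_nonempty {E ι : Type*} [SemilatticeInf E] [Nonempty ι]
    (hE : ∀ C : Set E, C.Nonempty → IsChain (· ≤ ·) C →
      (∃ a, IsGLB C a) ∧ (∃ b, IsLUB C b)) (H : ι → Set E)
    (hg : ∀ i, GoodSet (H i)) (hn : ∀ i, (H i).Nonempty)
    (hd : ∀ i j, ∃ k, H k ⊆ H i ∩ H j) : ∃ e, ∀ i, e ∈ H i := by
  obtain ⟨K, hK⟩ := zorn_superset {K : Set E | GoodSet K ∧ ∀ i, (K ∩ H i).Nonempty} (by
    intro c hcS hch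
    by_cases hcn : c.Nonempty
    · refine ⟨⋂₀ c, ⟨GoodSet.sInter fun K hK => (hcS hK).1, fun i => ?_⟩,
        fun s hs => sInter_subset_of_mem hs⟩
      have := GoodSet.chain_nonempty hE (c := (fun K => K ∩ H i) '' c)
        (by
          rintro _ ⟨K, hK, rfl⟩
          exact ⟨(hcS hK).1.inter (hg i), (hcS hK).2 i⟩)
        (by
          rintro _ ⟨K, hK, rfl⟩ _ ⟨L, hL, rfl⟩ -
          exact (hch.total hK hL).imp (fun h => inter_subset_inter_left _ h)
            (fun h => inter_subset_inter_left _ h))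
        (hcn.image _)
      obtain ⟨e, he⟩ := this
      refine ⟨e, fun K hK => (he _ ⟨K, hK, rfl⟩).1, ?_⟩
      obtain ⟨K, hK⟩ := hcn
      exact (he _ ⟨K, hK, rfl⟩).2
    · refine ⟨univ, ⟨⟨fun _ _ _ _ => trivial, fun _ _ _ _ _ _ => trivial,
        fun _ _ _ _ _ _ => trivial⟩, fun i => ?_⟩, fun s hs => (hcn ⟨s, hs⟩).elim⟩
      simpa using hn i)
  have hsub : ∀ i, K ⊆ H i := by
    intro i
    have h1 : GoodSet (K ∩ H i) ∧ ∀ j, ((K ∩ H i) ∩ H j).Nonempty := by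
      refine ⟨hK.1.1.inter (hg i), fun j => ?_⟩
      obtain ⟨k, hk⟩ := hd i j
      obtain ⟨e, he⟩ := hK.1.2 k
      exact ⟨e, ⟨he.1, (hk he.2).1⟩, (hk he.2).2⟩
    exact fun x hx => (hK.2 h1 inter_subset_left hx).2
  obtain ⟨e, he⟩ := hK.1.2 (Classical.arbitrary ι)
  exact ⟨e, fun i => hsub i he.1⟩

/-- iterated meets -/
def prodSeq {X : Type*} (f : X → X → X) (x : ℕ → X) : ℕ → ℕ → X
  | 0, n => x n
  | k + 1, n => f (x n) (prodSeq f x k (n + 1))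

/-- If `S` is a subsemilattice of a Hausdorff topological semilattice `Y`
and there is a closed homomorphism `h : S → E` into a complete topologized semilattice `E`
whose fibers are θ-closed in `Y`, then `S` is closed in `Y`. -/
theorem closed_of_closed_hom_theta_closed_fibers {Y E : Type*}
    [SemilatticeInf Y] [TopologicalSpace Y] [T2Space Y]
    (hYcont : Continuous fun p : Y × Y => p.1 ⊓ p.2)
    [SemilatticeInf E] [TopologicalSpace E]
    (hE : ∀ C : Set E, C.Nonempty → IsChain (· ≤ ·) C →
      ∃ a b : E, IsGLB C a ∧ IsLUB C b ∧ a ∈ closure C ∧ b ∈ closure C)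
    (S : Set Y) (hS : ∀ a ∈ S, ∀ b ∈ S, a ⊓ b ∈ S)
    (h : S → E)
    (hhom : ∀ a b : S, h ⟨(a : Y) ⊓ (b : Y), hS a a.2 b b.2⟩ = h a ⊓ h b)
    (hclosedmap : ∀ F : Set S, IsClosed F → IsClosed (h '' F))
    (hfib : ∀ e : E,
      thetaCl ((fun s : S => (s : Y)) '' (h ⁻¹' {e})) = (fun s : S => (s : Y)) '' (h ⁻¹' {e})) :
    IsClosed S := by
  classical
  have hE' : ∀ C : Set E, C.Nonempty → IsChain (· ≤ ·) C →
      (∃ a, IsGLB C a) ∧ (∃ b, IsLUB C b) := by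
    intro C h1 h2
    obtain ⟨a, b, ha, hb, -, -⟩ := hE C h1 h2
    exact ⟨⟨a, ha⟩, ⟨b, hb⟩⟩
  have hEg : ∀ C : Set E, C.Nonempty → IsChain (· ≤ ·) C → ∀ a, IsGLB C a → a ∈ closure C := by
    intro C h1 h2 a ha
    obtain ⟨a', b, ha', hb, h3, -⟩ := hE C h1 h2
    exact ha.unique ha' ▸ h3
  have hEl : ∀ C : Set E, C.Nonempty → IsChain (· ≤ ·) C → ∀ a, IsLUB C a → a ∈ closure C := by
    intro C h1 h2 a ha
    obtain ⟨a', b, ha', hb, -, h3⟩ := hE C h1 h2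
    exact ha.unique hb ▸ h3
  refine isClosed_of_closure_subset fun y hy => ?_
  let N : Set (ℕ → Set Y) := {u | (∀ n, IsOpen (u n) ∧ y ∈ u n) ∧
    ∀ n, ∀ a ∈ u (n + 1), ∀ b ∈ u (n + 1), a ⊓ b ∈ u n}
  have hNex : ∀ U : Set Y, IsOpen U → y ∈ U → ∃ u ∈ N, u 0 = U := by
    have step : ∀ U : {U : Set Y // IsOpen U ∧ y ∈ U}, ∃ V : {U : Set Y // IsOpen U ∧ y ∈ U},
        ∀ a ∈ V.1, ∀ b ∈ V.1, a ⊓ b ∈ U.1 := by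
      rintro ⟨U, hU, hyU⟩
      have h1 := (hU.preimage hYcont)
      obtain ⟨V, W, hV, hW, hyV, hyW, hVW⟩ := isOpen_prod_iff.1 h1 y y (by simpa using hyU)
      exact ⟨⟨V ∩ W, hV.inter hW, hyV, hyW⟩, fun a ha b hb =>
        hVW (show (a, b) ∈ V ×ˢ W from ⟨ha.1, hb.2⟩)⟩
    choose g hg using step
    intro U hU hyU
    refine ⟨fun n => (g^[n] ⟨U, hU, hyU⟩).1, ⟨fun n => (g^[n] ⟨U, hU, hyU⟩).2, fun n => ?_⟩, rfl⟩
    simp only [Function.iterate_succ_apply']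
    exact hg _
  let T : Set Y → Set E := fun U => h '' {s : S | (s : Y) ∈ closure U}
  have hTcl : ∀ U, IsClosed (T U) := fun U =>
    hclosedmap _ (isClosed_closure.preimage continuous_subtype_val)
  have hTmono : ∀ U V, U ⊆ V → T U ⊆ T V := fun U V hUV =>
    image_mono fun s hs => closure_mono hUV hs
  have hsucc : ∀ u ∈ N, ∀ n, u (n + 1) ⊆ u n := fun u hu n a ha => by
    simpa using hu.2 n a ha a ha
  have hanti : ∀ u ∈ N, Antitone u := fun u hu => antitone_nat_of_succ_le (hsucc u hu)
  let H : N → Set E := fun u => ⋂ n, T (u.1 n)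
  have hHcl : ∀ u, IsClosed (H u) := fun u => isClosed_iInter fun n => hTcl _
  obtain ⟨u0, hu0, -⟩ := hNex univ isOpen_univ trivial
  have : Nonempty N := ⟨⟨u0, hu0⟩⟩
  obtain ⟨e, he⟩ := GoodSet.directed_nonempty hE' H
    (by
      intro u
      refine ⟨fun a ha b hb => ?_, ?_, ?_⟩
      · refine mem_iInter.2 fun n => ?_
        obtain ⟨s, hs, rfl⟩ := mem_iInter.1 ha (n + 1)
        obtain ⟨t, ht, rfl⟩ := mem_iInter.1 hb (n + 1)
        refine ⟨⟨(s : Y) ⊓ t, hS s s.2 t t.2⟩, ?_, hhom s t⟩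
        exact map_mem_closure₂ (f := fun a b : Y => a ⊓ b) hYcont hs ht (u.2.2 n)
      · intro C hC hn hch a ha
        exact closure_minimal hC (hHcl u) (hEg C hn hch a ha)
      · intro C hC hn hch a ha
        exact closure_minimal hC (hHcl u) (hEl C hn hch a ha))
    (by
      rintro ⟨u, hu⟩
      have hx : ∀ n, ∃ s : S, (s : Y) ∈ u n := fun n => by
        obtain ⟨z, hz, hzS⟩ := mem_closure_iff.1 hy (u n) (hu.1 n).1 (hu.1 n).2
        exact ⟨⟨z, hzS⟩, hz⟩
      choose x hx using hx
      let p : ℕ → ℕ → S := prodSeq (fun a b : S => ⟨(a : Y) ⊓ (b : Y), hS a a.2 b b.2⟩) x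
      have hp1 : ∀ k n, h (p (k + 1) n) = h (x n) ⊓ h (p k (n + 1)) := fun k n => hhom _ _
      have hpu : ∀ k n, (p k (n + 1) : Y) ∈ u n := by
        intro k
        induction k with
        | zero => exact fun n => hsucc u hu n (hx (n + 1))
        | succ k ih => exact fun n => hu.2 n _ (hx (n + 1)) _ (ih (n + 1))
      have hpm : ∀ k n, h (p (k + 1) n) ≤ h (p k n) := by
        intro k
        induction k with
        | zero => exact fun n => (hp1 0 n).trans_le inf_le_left
        | succ k ih =>
          intro n
          rw [hp1 (k + 1) n, hp1 k n]
          exact inf_le_inf le_rfl (ih (n + 1))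
      have hpc : ∀ n, IsChain (· ≤ ·) (range fun k => h (p k (n + 1))) := fun n =>
        (antitone_nat_of_succ_le fun k => hpm k (n + 1)).isChain_range
      have hex := fun n => (hE' _ (range_nonempty _) (hpc n)).1
      choose a ha using hex
      have haT : ∀ n, a n ∈ T (u n) := fun n => by
        refine closure_minimal ?_ (hTcl (u n)) (hEg _ (range_nonempty _) (hpc n) _ (ha n))
        rintro _ ⟨k, rfl⟩
        exact ⟨_, subset_closure (hpu k n), rfl⟩
      have ham : Monotone a := monotone_nat_of_le_succ fun n => by
        apply (ha (n + 1)).2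
        rintro _ ⟨k, rfl⟩
        refine ((ha n).1 ⟨k + 1, rfl⟩).trans ?_
        exact (hp1 k (n + 1)).trans_le inf_le_right
      obtain ⟨-, b, hb⟩ := hE' _ (range_nonempty a) ham.isChain_range
      refine ⟨b, mem_iInter.2 fun n => ?_⟩
      refine closure_minimal ?_ (hTcl (u n)) (hEl (a '' Ici n) ⟨_, n, mem_Ici.2 le_rfl, rfl⟩
        (ham.isChain_range.mono (image_subset_range _ _)) b ⟨?_, fun z hz => hb.2 ?_⟩)
      · rintro _ ⟨k, hk, rfl⟩
        exact hTmono _ _ (hanti u hu hk) (haT k)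
      · rintro _ ⟨k, hk, rfl⟩
        exact hb.1 ⟨k, rfl⟩
      · rintro _ ⟨k, rfl⟩
        exact (ham (le_max_left k n)).trans (hz ⟨_, mem_Ici.2 (le_max_right k n), rfl⟩))
    (by
      rintro ⟨u, hu⟩ ⟨v, hv⟩
      refine ⟨⟨fun n => u n ∩ v n, fun n => ⟨(hu.1 n).1.inter (hv.1 n).1, (hu.1 n).2, (hv.1 n).2⟩,
        fun n a ha b hb => ⟨hu.2 n a ha.1 b hb.1, hv.2 n a ha.2 b hb.2⟩⟩, fun z hz => ⟨?_, ?_⟩⟩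
      · exact mem_iInter.2 fun n => hTmono _ _ inter_subset_left (mem_iInter.1 hz n)
      · exact mem_iInter.2 fun n => hTmono _ _ inter_subset_right (mem_iInter.1 hz n))
  have hyt : y ∈ thetaCl ((fun s : S => (s : Y)) '' (h ⁻¹' {e})) := by
    intro U hU hyU
    obtain ⟨u, hu, rfl⟩ := hNex U hU hyU
    obtain ⟨s, hs, hse⟩ := mem_iInter.1 (he ⟨u, hu⟩) 0
    exact ⟨s, hs, s, hse, rfl⟩
  rw [hfib e] at hyt
  obtain ⟨s, -, rfl⟩ := hyt
  exact s.2
end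

section
/- Let Y be a regular Hausdorff semitopological semilattice (the meet operation is separately continuous) and X ⊆ Y a subsemilattice with the subspace topology. If there exists a semilattice homomorphism h : X → E into a complete topologized semilattice E which is a closed map (the image under h of every set closed in X is closed in E) and such that for each e ∈ E the fiber h⁻¹(e) is closed in Y, then X is closed in Y. -/
open Set


section helpers
open Filter Topology Cardinal

def ChainCompl (E : Type*) [SemilatticeInf E] [TopologicalSpace E] : Prop :=
  ∀ C : Set E, C.Nonempty → IsChain (· ≤ ·) C →
      ∃ a b : E, IsGLB C a ∧ IsLUB C b ∧ a ∈ closure C ∧ b ∈ closure C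

theorem sup_tail {E ι : Type*} [SemilatticeInf E] [TopologicalSpace E] (hE : ChainCompl E)
    [LinearOrder ι] [Nonempty ι] (e : ι → E) (he : Monotone e) (A : ι → Set E)
    (hA : ∀ i, IsClosed (A i)) (heA : ∀ i j, i ≤ j → e j ∈ A i) : ∃ s, ∀ i, s ∈ A i := by
  have hch : ∀ T : Set ι, IsChain (· ≤ ·) (e '' T) := by
    rintro T _ ⟨a, -, rfl⟩ _ ⟨b, -, rfl⟩ -
    rcases le_total a b with h | h
    · exact Or.inl (he h)
    · exact Or.inr (he h)
  obtain ⟨-, s, -, hs, -, -⟩ := hE (e '' univ) (univ_nonempty.image e) (hch _)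
  refine ⟨s, fun i => ?_⟩
  obtain ⟨-, b, -, hb, -, hbc⟩ := hE (e '' Ici i) (nonempty_Ici.image e) (hch _)
  have : IsLUB (e '' univ) b := by
    constructor
    · rintro _ ⟨j, -, rfl⟩
      exact (he (le_max_left j i)).trans (hb.1 ⟨max j i, le_max_right _ _, rfl⟩)
    · intro c hc
      apply hb.2
      rintro _ ⟨j, -, rfl⟩
      exact hc ⟨j, trivial, rfl⟩
  rw [hs.unique this]
  refine closure_minimal ?_ (hA i) hbc
  rintro _ ⟨j, hj, rfl⟩
  exact heA i j hj

theorem exists_min {E : Type*} [SemilatticeInf E] [TopologicalSpace E] (hE : ChainCompl E)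
    (A L : Set E) (hA : IsClosed A) (hne : ∃ g ∈ A, ∀ l ∈ L, l ≤ g) :
    ∃ m, Minimal (fun e => e ∈ A ∧ ∀ l ∈ L, l ≤ e) m := by
  obtain ⟨g, hg⟩ := hne
  obtain ⟨m, -, hm⟩ := zorn_le_nonempty₀ (α := Eᵒᵈ) {e | OrderDual.ofDual e ∈ A ∧ ∀ l ∈ L, l ≤ OrderDual.ofDual e}
    (by
      intro c hc hcc y hy
      obtain ⟨a, -, ha, -, hac, -⟩ := hE (OrderDual.ofDual '' c) ⟨_, y, hy, rfl⟩ (by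
        rintro _ ⟨p, hp, rfl⟩ _ ⟨q, hq, rfl⟩ hpq
        exact (hcc hp hq (fun h => hpq (by rw [h]))).symm)
      refine ⟨OrderDual.toDual a, ⟨?_, ?_⟩, ?_⟩
      · refine closure_minimal ?_ hA hac
        rintro _ ⟨p, hp, rfl⟩
        exact (hc hp).1
      · intro l hl
        apply ha.2
        rintro _ ⟨p, hp, rfl⟩
        exact (hc hp).2 l hl
      · intro z hz
        exact ha.1 ⟨z, hz, rfl⟩) (OrderDual.toDual g) hg
  exact ⟨OrderDual.ofDual m, hm.1, fun x hx hxm => hm.2 (y := OrderDual.toDual x) hx hxm⟩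

variable {Y E : Type*} [SemilatticeInf Y] [TopologicalSpace Y] [RegularSpace Y]
  [SemilatticeInf E] [TopologicalSpace E]

theorem countable_case (hc : ∀ y : Y, Continuous fun x : Y => y ⊓ x)
    (hE : ChainCompl E) (S : Set Y) (H : Y → E)
    (hS : ∀ a ∈ S, ∀ b ∈ S, a ⊓ b ∈ S)
    (hH : ∀ a ∈ S, ∀ b ∈ S, H (a ⊓ b) = H a ⊓ H b)
    (hcl : ∀ K : Set Y, IsClosed K → IsClosed (H '' (K ∩ S)))
    (y : Y) (hy : y ∈ closure S) (U : ℕ → Set Y) (hU : ∀ n, U n ∈ 𝓝 y) :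
    ∃ g, ∀ n, ∃ x ∈ U n ∩ S, H x = g := by
  have h1 : ∀ n, ∃ V ∈ 𝓝 y, IsClosed V ∧ V ⊆ U n := fun n => exists_mem_nhds_isClosed_subset (hU n)
  choose V0 hV0 hV0c hV0U using h1
  let V : ℕ → Set Y := fun n => ⋂ k ∈ Set.Iic n, V0 k
  have hV : ∀ n, V n ∈ 𝓝 y := fun n => (biInter_mem (finite_Iic n)).2 fun k _ => hV0 k
  have hVc : ∀ n, IsClosed (V n) := fun n => isClosed_biInter fun k _ => hV0c k
  have hVU : ∀ n, V n ⊆ U n := fun n => (biInter_subset_of_mem (mem_Iic.2 le_rfl)).trans (hV0U n)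
  have hVanti : ∀ m n, m ≤ n → V n ⊆ V m := fun m n hmn =>
    biInter_subset_biInter_left (Iic_subset_Iic.2 hmn)
  have hmono : ∀ a ∈ S, ∀ b ∈ S, a ≤ b → H a ≤ H b := by
    intro a ha b hb hab
    have := hH a ha b hb
    rw [inf_eq_left.2 hab] at this
    rw [this]; exact inf_le_right
  have hyy : Tendsto (fun x => x ⊓ y) (𝓝 y) (𝓝 y) := by
    have := (hc y).tendsto y
    simpa [inf_comm] using this
  let Q : ℕ → (ℕ → Y) → Prop := fun n p => Monotone p ∧ (∀ i, p i ∈ S) ∧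
    ∀ i < n, p i ∈ V i ∧ p i ⊓ y ∈ interior (V i)
  have step : ∀ n p, Q n p → ∃ q, Q (n+1) q ∧ ∀ i < n, q i ≤ p i := by
    rintro n p ⟨hm, hpS, hp⟩
    have ev : ∀ᶠ x in 𝓝 y, (∀ i ∈ Set.Iio n, p i ⊓ x ∈ V i ∧ p i ⊓ (x ⊓ y) ∈ interior (V i)) ∧
        x ∈ V n ∧ x ⊓ y ∈ interior (V n) := by
      refine Filter.Eventually.and ?_ (Filter.Eventually.and (hV n) ?_)
      · refine (eventually_all_finite (finite_Iio n)).2 fun i hi => ?_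
        have t := (hc (p i)).tendsto y
        have ho : interior (V i) ∈ 𝓝 (p i ⊓ y) := isOpen_interior.mem_nhds (hp i hi).2
        refine Filter.Eventually.and ?_ ((t.comp hyy) ho)
        exact t (mem_of_superset ho interior_subset)
      · exact hyy (interior_mem_nhds.2 (hV n))
    obtain ⟨x, ⟨hx1, hx2, hx3⟩, hxS⟩ := mem_closure_iff_nhds.1 hy _ ev
    refine ⟨fun i => if i < n then p i ⊓ x else x, ⟨?_, ?_, ?_⟩, ?_⟩
    · intro i j hij
      dsimp only
      split_ifs with h1 h2
      · exact inf_le_inf_right _ (hm hij)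
      · exact inf_le_right
      · omega
      · exact le_rfl
    · intro i
      dsimp only
      split_ifs
      · exact hS _ (hpS i) _ hxS
      · exact hxS
    · intro i hi
      dsimp only
      split_ifs with h1
      · rw [inf_assoc]; exact hx1 i h1
      · obtain rfl : i = n := by omega
        exact ⟨hx2, hx3⟩
    · intro i hi
      simp only [hi, if_true]
      exact inf_le_left
  obtain ⟨x0, hx0⟩ : S.Nonempty := closure_nonempty_iff.1 ⟨y, hy⟩
  choose! nx hnx1 hnx2 using step
  let P : ℕ → ℕ → Y := fun n => Nat.rec (fun _ => x0) (fun n p => nx n p) n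
  have hQ : ∀ n, Q n (P n) := by
    intro n
    induction n with
    | zero => exact ⟨fun _ _ _ => le_rfl, fun _ => hx0, fun i hi => absurd hi (by omega)⟩
    | succ n ih => exact hnx1 n _ ih
  have hdec : ∀ n i, i < n → P (n+1) i ≤ P n i := fun n i hi => hnx2 n _ (hQ n) i hi
  have hdec' : ∀ i m n, i < m → m ≤ n → P n i ≤ P m i := by
    intro i m n him hmn
    induction n, hmn using Nat.le_induction with
    | base => exact le_rfl
    | succ n hn ih => exact (hdec n i (by omega)).trans ih
  have hinf : ∀ i, ∃ e, IsGLB ((fun n => H (P n i)) '' Ioi i) e ∧ e ∈ H '' (V i ∩ S) := by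
    intro i
    obtain ⟨a, -, ha, -, hac, -⟩ := hE ((fun n => H (P n i)) '' Ioi i) (nonempty_Ioi.image _) (by
      rintro _ ⟨m, hm, rfl⟩ _ ⟨n, hn, rfl⟩ -
      rcases le_total m n with h | h
      · exact Or.inr (hmono _ ((hQ n).2.1 i) _ ((hQ m).2.1 i) (hdec' i m n hm h))
      · exact Or.inl (hmono _ ((hQ m).2.1 i) _ ((hQ n).2.1 i) (hdec' i n m hn h)))
    refine ⟨a, ha, closure_minimal ?_ (hcl _ (hVc i)) hac⟩
    rintro _ ⟨m, hm, rfl⟩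
    exact ⟨_, ⟨((hQ m).2.2 i hm).1, (hQ m).2.1 i⟩, rfl⟩
  choose e he1 he2 using hinf
  have hem : Monotone e := by
    refine monotone_nat_of_le_succ fun i => ?_
    apply (he1 (i+1)).2
    rintro _ ⟨n, hn, rfl⟩
    have hn' : i + 1 < n := hn
    have h1 : e i ≤ H (P n i) := (he1 i).1 ⟨n, by simp only [mem_Ioi]; omega, rfl⟩
    exact h1.trans (hmono _ ((hQ n).2.1 _) _ ((hQ n).2.1 _) ((hQ n).1 (Nat.le_succ i)))
  obtain ⟨s, hs⟩ := sup_tail hE e hem (fun i => H '' (V i ∩ S)) (fun i => hcl _ (hVc i))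
    (fun i j hij => image_mono (inter_subset_inter_left _ (hVanti i j hij)) (he2 j))
  refine ⟨s, fun n => ?_⟩
  obtain ⟨x, hx, hxs⟩ := hs n
  exact ⟨x, ⟨hVU n hx.1, hx.2⟩, hxs⟩

theorem exists_nhds_seq (y : Y) (U : Set Y) (hU : U ∈ 𝓝 y) : ∃ V : ℕ → Set Y, V 0 ⊆ U ∧
    ∀ n, V n ∈ 𝓝 y ∧ IsClosed (V n) ∧ V (n+1) ⊆ interior (V n) := by
  have h : ∀ W : Set Y, W ∈ 𝓝 y → ∃ V, V ∈ 𝓝 y ∧ IsClosed V ∧ V ⊆ interior W := fun W hW => by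
    obtain ⟨V, h1, h2, h3⟩ := exists_mem_nhds_isClosed_subset (interior_mem_nhds.2 hW)
    exact ⟨V, h1, h2, h3⟩
  choose! f hf1 hf2 hf3 using h
  let V : ℕ → Set Y := fun n => Nat.rec (f U) (fun _ W => f W) n
  have hn : ∀ n, V n ∈ 𝓝 y ∧ IsClosed (V n) := by
    intro n
    induction n with
    | zero => exact ⟨hf1 U hU, hf2 U hU⟩
    | succ n ih => exact ⟨hf1 _ ih.1, hf2 _ ih.1⟩
  exact ⟨V, (hf3 U hU).trans interior_subset, fun n => ⟨(hn n).1, (hn n).2, hf3 _ (hn n).1⟩⟩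

theorem general_case (hc : ∀ y : Y, Continuous fun x : Y => y ⊓ x)
    (hE : ChainCompl E) (S : Set Y) (H : Y → E)
    (hS : ∀ a ∈ S, ∀ b ∈ S, a ⊓ b ∈ S)
    (hH : ∀ a ∈ S, ∀ b ∈ S, H (a ⊓ b) = H a ⊓ H b)
    (hcl : ∀ K : Set Y, IsClosed K → IsClosed (H '' (K ∩ S)))
    (y : Y) (hy : y ∈ closure S) (c : Cardinal) : ∀ (ι : Type*) (_ : #ι = c)
    (U : ι → Set Y) (_ : ∀ n, U n ∈ 𝓝 y), ∃ g, ∀ n, ∃ x ∈ U n ∩ S, H x = g := by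
  induction c using WellFoundedLT.induction with
  | ind c IH =>
  intro ι hι U hU
  rcases isEmpty_or_nonempty ι with hemp | hne
  · exact ⟨H y, fun n => (hemp.false n).elim⟩
  by_cases hcount : Countable ι
  · obtain ⟨f, hf⟩ := exists_surjective_nat ι
    obtain ⟨g, hg⟩ := countable_case hc hE S H hS hH hcl y hy (fun n => U (f n)) (fun n => hU _)
    refine ⟨g, fun n => ?_⟩
    obtain ⟨m, rfl⟩ := hf n
    exact hg m
  have hunc : ℵ₀ < #ι := by
    rw [← not_le, Cardinal.mk_le_aleph0_iff]; exact hcount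
  obtain ⟨_, _, hord⟩ := Cardinal.exists_ord_eq_type_lt ι
  have hIio : ∀ i : ι, #(Iio i) < #ι := fun i => Cardinal.mk_Iio_lt i hord
  have hIic : ∀ i : ι, #(Iic i) < #ι := fun i => by
    rw [← Iio_insert]
    exact (Cardinal.mk_insert_le).trans_lt
      (Cardinal.add_lt_of_lt hunc.le (hIio i) (Cardinal.one_lt_aleph0.trans hunc))
  have hyy : Tendsto (fun x => x ⊓ y) (𝓝 y) (𝓝 y) := by
    have := (hc y).tendsto y
    simpa [inf_comm] using this
  have hyc : Continuous (fun x => x ⊓ y) := by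
    simpa [inf_comm] using hc y
  choose V hV0 hV using fun i => exists_nhds_seq y (U i) (hU i)
  let B : ι → ℕ → Set Y := fun i n => {x | x ∈ V i n ∧ x ⊓ y ∈ V i n}
  have hBc : ∀ i n, IsClosed (B i n) := fun i n =>
    (hV i n).2.1.inter ((hV i n).2.1.preimage hyc)
  have hBn : ∀ i n, B i n ∈ 𝓝 y := fun i n => inter_mem (hV i n).1 (hyy (hV i n).1)
  let A : ι → Set E := fun i => {e | ∀ j ≤ i, ∀ n, e ∈ H '' (B j n ∩ S)}
  have hAc : ∀ i, IsClosed (A i) := by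
    intro i
    simp only [A, setOf_forall]
    exact isClosed_iInter fun j => isClosed_iInter fun _ => isClosed_iInter fun n => hcl _ (hBc j n)
  classical
  let e : ι → E := (inferInstance : WellFoundedLT ι).wf.fix (fun i f =>
    if h : ∃ m, Minimal (fun e => e ∈ A i ∧ ∀ l ∈ {l | ∃ j, ∃ hj : j < i, f j hj = l}, l ≤ e) m
      then h.choose else H y)
  have hefix : ∀ i, (∃ g ∈ A i, ∀ j < i, e j ≤ g) →
      Minimal (fun a => a ∈ A i ∧ ∀ j < i, e j ≤ a) (e i) := by
    intro i hi
    have h : ∃ m, Minimal (fun a => a ∈ A i ∧ ∀ l ∈ {l | ∃ j, ∃ hj : j < i, e j = l}, l ≤ a) m := by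
      apply exists_min hE _ _ (hAc i)
      obtain ⟨g, hg, hg'⟩ := hi
      exact ⟨g, hg, by rintro _ ⟨j, hj, rfl⟩; exact hg' j hj⟩
    have h2 : e i = h.choose := by
      have := WellFounded.fix_eq (inferInstance : WellFoundedLT ι).wf (fun i (f : ∀ j, j < i → E) =>
        if h : ∃ m, Minimal (fun e => e ∈ A i ∧ ∀ l ∈ {l | ∃ j, ∃ hj : j < i, f j hj = l}, l ≤ e) m
        then h.choose else H y) i
      exact this.trans (dif_pos h)
    have h3 := h.choose_spec
    rw [← h2] at h3
    refine ⟨⟨h3.1.1, fun j hj => h3.1.2 _ ⟨j, hj, rfl⟩⟩, fun a ha hae => h3.2 ⟨ha.1, ?_⟩ hae⟩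
    rintro _ ⟨j, hj, rfl⟩
    exact ha.2 j hj
  have hmin : ∀ i, Minimal (fun a => a ∈ A i ∧ ∀ j < i, e j ≤ a) (e i) := by
    intro i
    induction i using WellFoundedLT.induction with
    | ind i ih =>
    apply hefix
    have hz : ∀ b j : ι, ∀ n : ℕ, ∃ W ∈ 𝓝 y, b < i → j ≤ b →
        ∀ x ∈ W ∩ S, e b ⊓ H x ∈ H '' (B j n ∩ S) := by
      intro b j n
      by_cases hb : b < i ∧ j ≤ b
      · obtain ⟨z, ⟨hz, hzS⟩, hze⟩ := (ih b hb.1).1.1 j hb.2 (n+1)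
        have t := (hc z).tendsto y
        have ho : V j n ∈ 𝓝 (z ⊓ y) := mem_interior_iff_mem_nhds.1 ((hV j n).2.2 hz.2)
        refine ⟨{x | z ⊓ x ∈ V j n ∧ z ⊓ (x ⊓ y) ∈ V j n}, inter_mem (t ho) ((t.comp hyy) ho), ?_⟩
        rintro - - x ⟨⟨hx1, hx2⟩, hxS⟩
        refine ⟨z ⊓ x, ⟨⟨hx1, ?_⟩, hS _ hzS _ hxS⟩, ?_⟩
        · rw [inf_assoc]; exact hx2
        · rw [hH _ hzS _ hxS, hze]
      · exact ⟨univ, univ_mem, fun h1 h2 => absurd ⟨h1, h2⟩ hb⟩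
    choose W hW1 hW2 using hz
    have hcard : #(Iic i × Iic i × ℕ) < c := by
      rw [← hι]
      simp only [Cardinal.mk_prod, Cardinal.lift_id, Cardinal.lift_uzero, Cardinal.mk_nat, Cardinal.lift_aleph0]
      exact Cardinal.mul_lt_of_lt hunc.le (hIic i) (Cardinal.mul_lt_of_lt hunc.le (hIic i) hunc)
    obtain ⟨g, hg⟩ := IH _ hcard (Iic i × Iic i × ℕ) rfl
      (fun t => B t.2.1 t.2.2 ∩ W t.1 t.2.1 t.2.2) (fun t => inter_mem (hBn _ _) (hW1 _ _ _))
    refine ⟨g, ?_, ?_⟩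
    · intro j hj n
      obtain ⟨x, hx, hxg⟩ := hg (⟨i, le_rfl⟩, ⟨j, hj⟩, n)
      exact ⟨x, ⟨hx.1.1, hx.2⟩, hxg⟩
    · intro b
      induction b using WellFoundedLT.induction with
      | ind b ihb =>
      intro hb
      have hm := ih b hb
      have : e b ≤ e b ⊓ g := by
        refine hm.2 ⟨?_, ?_⟩ inf_le_left
        · intro j hj n
          obtain ⟨x, hx, rfl⟩ := hg (⟨b, hb.le⟩, ⟨j, hj.trans hb.le⟩, n)
          exact hW2 b j n hb hj x ⟨hx.1.2, hx.2⟩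
        · intro j hj
          exact le_inf (hm.1.2 j hj) (ihb j hj (hj.trans hb))
      exact this.trans inf_le_right
  have hem : Monotone e := by
    intro i j hij
    rcases hij.eq_or_lt with rfl | h
    · exact le_rfl
    · exact (hmin j).1.2 i h
  obtain ⟨s, hs⟩ := sup_tail hE e hem A hAc
    (fun i j hij k hk n => (hmin j).1.1 k (hk.trans hij) n)
  refine ⟨s, fun i => ?_⟩
  obtain ⟨x, hx, hxs⟩ := hs i i le_rfl 0
  exact ⟨x, ⟨hV0 i hx.1.1, hx.2⟩, hxs⟩

end helpers

/-- If `S` is a subsemilattice of a regular Hausdorff semitopological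
semilattice `Y` and there is a closed homomorphism `h : S → E` into a complete topologized
semilattice `E` whose fibers are closed in `Y`, then `S` is closed in `Y`. -/
theorem closed_of_closed_hom_closed_fibers {Y E : Type*}
    [SemilatticeInf Y] [TopologicalSpace Y] [T2Space Y] [RegularSpace Y]
    (hYcont₁ : ∀ y : Y, Continuous fun x : Y => x ⊓ y)
    (hYcont₂ : ∀ y : Y, Continuous fun x : Y => y ⊓ x)
    [SemilatticeInf E] [TopologicalSpace E]
    (hE : ∀ C : Set E, C.Nonempty → IsChain (· ≤ ·) C →
      ∃ a b : E, IsGLB C a ∧ IsLUB C b ∧ a ∈ closure C ∧ b ∈ closure C)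
    (S : Set Y) (hS : ∀ a ∈ S, ∀ b ∈ S, a ⊓ b ∈ S)
    (h : S → E)
    (hhom : ∀ a b : S, h ⟨(a : Y) ⊓ (b : Y), hS a a.2 b b.2⟩ = h a ⊓ h b)
    (hclosedmap : ∀ F : Set S, IsClosed F → IsClosed (h '' F))
    (hfib : ∀ e : E, IsClosed ((fun s : S => (s : Y)) '' (h ⁻¹' {e}))) :
    IsClosed S := by
  classical
  refine isClosed_of_closure_subset fun y hy => ?_
  obtain ⟨x0, hx0⟩ : S.Nonempty := closure_nonempty_iff.1 ⟨y, hy⟩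
  let H : Y → E := fun x => if hx : x ∈ S then h ⟨x, hx⟩ else h ⟨x0, hx0⟩
  have hHS : ∀ x (hx : x ∈ S), H x = h ⟨x, hx⟩ := fun x hx => dif_pos hx
  obtain ⟨g, hg⟩ := general_case hYcont₂ hE S H hS
    (by
      intro a ha b hb
      rw [hHS a ha, hHS b hb, hHS _ (hS a ha b hb)]
      exact hhom ⟨a, ha⟩ ⟨b, hb⟩)
    (by
      intro K hK
      have := hclosedmap (Subtype.val ⁻¹' K) (hK.preimage continuous_subtype_val)
      convert this using 1
      ext e
      constructor
      · rintro ⟨x, ⟨hxK, hxS⟩, rfl⟩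
        exact ⟨⟨x, hxS⟩, hxK, (hHS x hxS).symm⟩
      · rintro ⟨⟨x, hxS⟩, hxK, rfl⟩
        exact ⟨x, ⟨hxK, hxS⟩, hHS x hxS⟩)
    y hy _ {U : Set Y // U ∈ nhds y} rfl (fun U => U.1) (fun U => U.2)
  have hmem : y ∈ closure ((fun s : S => (s : Y)) '' (h ⁻¹' {g})) := by
    rw [mem_closure_iff_nhds]
    intro U hU
    obtain ⟨x, ⟨hxU, hxS⟩, hx⟩ := hg ⟨U, hU⟩
    exact ⟨x, hxU, ⟨x, hxS⟩, (hHS x hxS).symm.trans hx, rfl⟩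
  rw [(hfib g).closure_eq] at hmem
  obtain ⟨s, -, rfl⟩ := hmem
  exact s.2
end

section
/- For a δ-↑↓-closed topologized semilattice X the following are equivalent: (1) X is δ-complete; (2) X is weak δ-chain•-compact; (3) every cover of a δ-closed chain C ⊆ X by δ-open subsets of X contains a finite subcover of C. -/
open Set TopologicalSpace

/-- The δ-closure of a set in a topological space. -/
def deltaCl {X : Type*} [TopologicalSpace X] (A : Set X) : Set X :=
  {x | ∀ U : Set X, IsOpen U → x ∈ U → (interior (closure U) ∩ A).Nonempty}

open scoped Topology

lemma dcl_mono {X : Type*} [TopologicalSpace X] {A B : Set X} (h : A ⊆ B) :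
    deltaCl A ⊆ deltaCl B := fun _ hx U hU hxU =>
  (hx U hU hxU).mono (inter_subset_inter_right _ h)

lemma dcl_sub {X : Type*} [TopologicalSpace X] (A : Set X) : A ⊆ deltaCl A :=
  fun x hx _ hU hxU => ⟨x, hU.subset_interior_closure hxU, hx⟩

lemma dcl_idem {X : Type*} [TopologicalSpace X] (A : Set X) :
    deltaCl (deltaCl A) = deltaCl A := by
  refine Subset.antisymm ?_ (dcl_sub _)
  intro x hx U hU hxU
  obtain ⟨y, hy, hyA⟩ := hx U hU hxU
  obtain ⟨z, hz, hzA⟩ := hyA _ isOpen_interior hy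
  refine ⟨z, ?_, hzA⟩
  have : closure (interior (closure U)) ⊆ closure U :=
    closure_minimal interior_subset isClosed_closure
  exact interior_mono this hz

lemma dcl_union {X : Type*} [TopologicalSpace X] (A B : Set X) :
    deltaCl (A ∪ B) = deltaCl A ∪ deltaCl B := by
  refine Subset.antisymm ?_
    (union_subset (dcl_mono subset_union_left) (dcl_mono subset_union_right))
  intro x hx
  by_contra hn
  simp only [mem_union, not_or] at hn
  obtain ⟨hA, hB⟩ := hn
  simp only [deltaCl, mem_ofPred_eq, not_forall] at hA hB
  obtain ⟨U, hU, hxU, hUA⟩ := hA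
  obtain ⟨V, hV, hxV, hVB⟩ := hB
  obtain ⟨z, hz, hzAB⟩ := hx (U ∩ V) (hU.inter hV) ⟨hxU, hxV⟩
  rcases hzAB with h | h
  · exact hUA ⟨z, interior_mono (closure_mono inter_subset_left) hz, h⟩
  · exact hVB ⟨z, interior_mono (closure_mono inter_subset_right) hz, h⟩

lemma dcl_top (X : Type*) [s : TopologicalSpace X] :
    ∃ t : TopologicalSpace X, (@deltaCl X s) = @closure X t := by
  let t : TopologicalSpace X := TopologicalSpace.ofClosed {A | @deltaCl X s A = A}
    (by
      ext x
      simp only [mem_empty_iff_false, iff_false]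
      intro hx
      obtain ⟨z, _, hz⟩ := hx univ isOpen_univ trivial
      exact hz)
    (by
      intro 𝒜 h𝒜
      refine Subset.antisymm ?_ (dcl_sub _)
      intro x hx A hA
      have : @deltaCl X s A = A := h𝒜 hA
      rw [← this]
      exact dcl_mono (sInter_subset_of_mem hA) hx)
    (by
      intro A hA B hB
      have hA : @deltaCl X s A = A := hA
      have hB : @deltaCl X s B = B := hB
      change @deltaCl X s (A ∪ B) = A ∪ B
      rw [dcl_union, hA, hB])
  have hcl : ∀ A : Set X, IsClosed[t] A ↔ @deltaCl X s A = A := by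
    intro A
    rw [← @isOpen_compl_iff X A t]
    change @deltaCl X s Aᶜᶜ = Aᶜᶜ ↔ _
    rw [compl_compl]
  refine ⟨t, funext fun A => Subset.antisymm ?_ ?_⟩
  · have h := (hcl _).1 (@isClosed_closure X t A)
    rw [← h]
    exact @dcl_mono X s _ _ (@subset_closure X t A)
  · exact @closure_minimal X t _ _ (@dcl_sub X s A) ((hcl _).2 (@dcl_idem X s A))

lemma chain_compact {X : Type*} [PartialOrder X] [TopologicalSpace X]
    (h1 : ∀ C : Set X, C.Nonempty → IsChain (· ≤ ·) C →
        ∃ a b : X, IsGLB C a ∧ IsLUB C b ∧ a ∈ closure C ∧ b ∈ closure C)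
    (C : Set X) (hC : IsClosed C) (hch : IsChain (· ≤ ·) C) : IsCompact C := by
  rw [isCompact_iff_ultrafilter_le_nhds']
  intro F hF
  have hne : C.Nonempty := F.nonempty_of_mem hF
  obtain ⟨a, -, ha, -, haC, -⟩ := h1 C hne hch
  rw [hC.closure_eq] at haC
  set L : Set X := {x | x ∈ C ∧ Ici x ∈ F} with hL
  have haL : a ∈ L := ⟨haC, Filter.mem_of_superset hF ha.1⟩
  have hLC : L ⊆ C := fun x hx => hx.1
  obtain ⟨-, b, -, hb, -, hbL⟩ := h1 L ⟨a, haL⟩ (hch.mono hLC)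
  have hbC : b ∈ C := closure_minimal hLC hC hbL
  refine ⟨b, hbC, ?_⟩
  intro V hV
  obtain ⟨U, hUV, hU, hbU⟩ := mem_nhds_iff.1 hV
  refine Filter.mem_of_superset ?_ hUV
  by_contra hUF
  have hUc : Uᶜ ∈ F := Ultrafilter.compl_mem_iff_notMem.2 hUF
  have key : ∃ l ∈ L, ∀ x ∈ C, x ∉ U → l ≤ x → ¬ x < b := by
    by_cases hD : ({x | x ∈ C ∧ x < b ∧ x ∉ U} : Set X).Nonempty
    · have hDC : ({x | x ∈ C ∧ x < b ∧ x ∉ U} : Set X) ⊆ C := fun x hx => hx.1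
      obtain ⟨-, d, -, hd, -, hdD⟩ := h1 _ hD (hch.mono hDC)
      have hdC : d ∈ C := closure_minimal hDC hC hdD
      have hdU : d ∈ Uᶜ := closure_minimal (fun x hx => hx.2.2) hU.isClosed_compl hdD
      have hdb : d ≤ b := hd.2 fun x hx => hx.2.1.le
      by_contra hcon
      push Not at hcon
      have : b ≤ d := by
        refine hb.2 fun l hl => ?_
        obtain ⟨x, hxC, hxU, hlx, hxb⟩ := hcon l hl
        exact hlx.trans (hd.1 ⟨hxC, hxb, hxU⟩)
      exact hdU (le_antisymm hdb this ▸ hbU)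
    · exact ⟨a, haL, fun x hx hxU _ hxb => hD ⟨x, hx, hxb, hxU⟩⟩
  obtain ⟨l, hl, hlx⟩ := key
  have hEF : ({x | x ∈ C ∧ b ≤ x ∧ x ∉ U} : Set X) ∈ F := by
    refine Filter.mem_of_superset (Filter.inter_mem (Filter.inter_mem hF hUc) hl.2) ?_
    rintro x ⟨⟨hxC, hxU⟩, hx⟩
    refine ⟨hxC, ?_, hxU⟩
    rcases hch.total hxC hbC with h | h
    · rcases h.eq_or_lt with h | h
      · exact h.ge
      · exact absurd h (hlx x hxC hxU hx)
    · exact h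
  have hEC : ({x | x ∈ C ∧ b ≤ x ∧ x ∉ U} : Set X) ⊆ C := fun x hx => hx.1
  obtain ⟨d, -, hd, -, hdD, -⟩ := h1 _ (F.nonempty_of_mem hEF) (hch.mono hEC)
  have hdC : d ∈ C := closure_minimal hEC hC hdD
  have hdU : d ∈ Uᶜ := closure_minimal (fun x hx => hx.2.2) hU.isClosed_compl hdD
  have hbd : b ≤ d := hd.2 fun x hx => hx.2.1
  have hdL : d ∈ L := ⟨hdC, Filter.mem_of_superset hEF hd.1⟩
  exact hdU (le_antisymm hbd (hb.1 hdL) ▸ hbU)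

lemma chain_closure {X : Type*} [PartialOrder X] [TopologicalSpace X]
    (hi : ∀ x : X, IsClosed (Ici x)) (hd : ∀ x : X, IsClosed (Iic x))
    {C : Set X} (hC : IsChain (· ≤ ·) C) : IsChain (· ≤ ·) (closure C) := by
  have s1 : ∀ x ∈ C, ∀ y ∈ closure C, y ∈ Ici x ∪ Iic x := fun x hx y hy =>
    closure_minimal (fun z hz => hC.total hx hz) ((hi x).union (hd x)) hy
  intro x hx y hy _
  exact closure_minimal (t := Ici x ∪ Iic x) (fun z hz => (s1 z hz x hx).symm)
    ((hi x).union (hd x)) hy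

lemma fip {X ι : Type*} (w : TopologicalSpace X) (hw : CompactSpace X) [Nonempty ι]
    (t : ι → Set X) (htd : Directed (· ⊇ ·) t)
    (htn : ∀ i, (t i).Nonempty) (htcl : ∀ i, IsClosed (t i)) : ∃ x, ∀ i, x ∈ t i := by
  obtain ⟨x, hx⟩ := IsCompact.nonempty_iInter_of_directed_nonempty_isCompact_isClosed t htd htn
    (fun i => (htcl i).isCompact) htcl
  exact ⟨x, mem_iInter.1 hx⟩

lemma core_tfae {X : Type*} [SemilatticeInf X] [t : TopologicalSpace X]
    (hud : ∀ x : X, closure {y : X | x ≤ y} = {y : X | x ≤ y} ∧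
      closure {y : X | y ≤ x} = {y : X | y ≤ x}) :
    List.TFAE
      [∀ C : Set X, C.Nonempty → IsChain (· ≤ ·) C →
        ∃ a b : X, IsGLB C a ∧ IsLUB C b ∧ a ∈ closure C ∧ b ∈ closure C,
      @CompactSpace X (generateFrom
        {U : Set X | ∃ C : Set X, closure C = C ∧ IsChain (· ≤ ·) C ∧ U = Cᶜ}),
      ∀ C : Set X, closure C = C → IsChain (· ≤ ·) C →
        ∀ 𝒰 : Set (Set X), (∀ U ∈ 𝒰, closure Uᶜ = Uᶜ) → C ⊆ ⋃₀ 𝒰 →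
          ∃ ℱ ⊆ 𝒰, ℱ.Finite ∧ C ⊆ ⋃₀ ℱ] := by
  have ht : ∀ A : Set X, IsClosed[t] A ↔ @closure X t A = A := fun A => closure_eq_iff_isClosed.symm
  have hi : ∀ x : X, IsClosed[t] (Ici x) := fun x => (ht _).2 (hud x).1
  have hd : ∀ x : X, IsClosed[t] (Iic x) := fun x => (ht _).2 (hud x).2
  tfae_have 1 → 3 := by
    intro h1 C hC hch 𝒰 h𝒰 hcov
    have hc : @IsCompact X t C := by
      exact @chain_compact X _ t h1 C ((ht C).2 hC) hch
    rw [sUnion_eq_biUnion] at hcov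
    obtain ⟨ℱ, h1, h2, h3⟩ := @IsCompact.elim_finite_subcover_image X _ t C 𝒰 id hc
      (fun U hU => (@isClosed_compl_iff X t U).1 ((ht _).2 (h𝒰 U hU))) hcov
    refine ⟨ℱ, h1, h2, ?_⟩
    rwa [sUnion_eq_biUnion]
  tfae_have 3 → 2 := by
    intro h3
    refine @CompactSpace.mk X (_) ?_
    refine @isCompact_generateFrom X (_) _ rfl univ ?_
    intro P hP hcov
    rcases P.eq_empty_or_nonempty with rfl | ⟨U, hU⟩
    · exact ⟨∅, Subset.rfl, finite_empty, hcov⟩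
    · obtain ⟨C, hC, hch, rfl⟩ := hP hU
      obtain ⟨ℱ, hs, hf, hc⟩ := h3 C hC hch P (by
        intro V hV
        obtain ⟨D, hD, -, rfl⟩ := hP hV
        rwa [compl_compl]) (fun x _ => hcov (mem_univ x))
      refine ⟨insert Cᶜ ℱ, insert_subset hU hs, hf.insert _, ?_⟩
      intro x _
      by_cases hx : x ∈ C
      · obtain ⟨V, hV, hxV⟩ := hc hx
        exact ⟨V, mem_insert_of_mem _ hV, hxV⟩
      · exact ⟨Cᶜ, mem_insert _ _, hx⟩
  tfae_have 2 → 1 := by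
    intro h2 C hne hch
    have hK : IsChain (· ≤ ·) (closure C) := by
      exact @chain_closure X _ t hi hd C hch
    have hKc : IsClosed[t] (closure C) := (ht _).2 (closure_closure)
    have hw : ∀ S : Set X, IsClosed[t] S → IsClosed[generateFrom
        {U : Set X | ∃ C : Set X, closure C = C ∧ IsChain (· ≤ ·) C ∧ U = Cᶜ}]
        (closure C ∩ S) := by
      intro S hS
      refine (@isOpen_compl_iff X _ (_)).1 (isOpen_generateFrom_of_mem ⟨_, ?_, ?_, rfl⟩)
      · exact (ht _).1 (@IsClosed.inter X _ _ t hKc hS)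
      · exact hK.mono inter_subset_left
    have : Nonempty C := hne.to_subtype
    obtain ⟨b, hb⟩ := fip _ h2 (fun x : C => closure C ∩ Ici (x : X)) (by
      intro x y
      rcases hch.total x.2 y.2 with h | h
      · exact ⟨y, inter_subset_inter_right _ (Ici_subset_Ici.2 h), Subset.rfl⟩
      · exact ⟨x, Subset.rfl, inter_subset_inter_right _ (Ici_subset_Ici.2 h)⟩)
      (fun x => ⟨x, @subset_closure X t C _ x.2, le_rfl⟩) (fun x => hw _ (hi x))
    obtain ⟨a, ha⟩ := fip _ h2 (fun x : C => closure C ∩ Iic (x : X)) (by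
      intro x y
      rcases hch.total x.2 y.2 with h | h
      · exact ⟨x, Subset.rfl, inter_subset_inter_right _ (Iic_subset_Iic.2 h)⟩
      · exact ⟨y, inter_subset_inter_right _ (Iic_subset_Iic.2 h), Subset.rfl⟩)
      (fun x => ⟨x, @subset_closure X t C _ x.2, le_rfl⟩) (fun x => hw _ (hd x))
    have haC : a ∈ closure C := (ha (Classical.arbitrary _)).1
    have hbC : b ∈ closure C := (hb (Classical.arbitrary _)).1
    refine ⟨a, b, ⟨fun x hx => (ha ⟨x, hx⟩).2, fun u hu => ?_⟩,
      ⟨fun x hx => (hb ⟨x, hx⟩).2, fun u hu => ?_⟩, haC, hbC⟩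
    · have h := closure_mono (t := {y : X | u ≤ y}) (fun x hx => hu hx) haC
      rw [(hud u).1] at h
      exact h
    · have h := closure_mono (t := {y : X | y ≤ u}) (fun x hx => hu hx) hbC
      rw [(hud u).2] at h
      exact h
  tfae_finish

/-- For a δ-↑↓-closed topologized semilattice the following are
equivalent: (1) δ-completeness; (2) weak δ-chain•-compactness; (3) every cover of a
δ-closed chain by δ-open sets has a finite subcover. -/
theorem delta_complete_tfae {X : Type*} [SemilatticeInf X] [TopologicalSpace X]
    (hud : ∀ x : X, deltaCl {y : X | x ≤ y} = {y : X | x ≤ y} ∧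
      deltaCl {y : X | y ≤ x} = {y : X | y ≤ x}) :
    List.TFAE
      [∀ C : Set X, C.Nonempty → IsChain (· ≤ ·) C →
        ∃ a b : X, IsGLB C a ∧ IsLUB C b ∧ a ∈ deltaCl C ∧ b ∈ deltaCl C,
      @CompactSpace X (generateFrom
        {U : Set X | ∃ C : Set X, deltaCl C = C ∧ IsChain (· ≤ ·) C ∧ U = Cᶜ}),
      ∀ C : Set X, deltaCl C = C → IsChain (· ≤ ·) C →
        ∀ 𝒰 : Set (Set X), (∀ U ∈ 𝒰, deltaCl Uᶜ = Uᶜ) → C ⊆ ⋃₀ 𝒰 →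
          ∃ ℱ ⊆ 𝒰, ℱ.Finite ∧ C ⊆ ⋃₀ ℱ] := by
  obtain ⟨t, ht⟩ := dcl_top X
  rw [ht] at hud ⊢
  exact @core_tfae X _ t hud
end
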